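/- arXiv:2603.29124 — 2 statements merged into one kernel-verified Lean document; each statement's English description precedes it below -/
import Mathlib

section
/- Suppose 0 < p < 1 and Assumptions A1 and A2 hold. Let (x,λ) be a global solution of the dynamical system, let (x_t,λ_t) be the unique saddle point of L_t with t ↦ (x_t,λ_t) continuously differentiable, and let E be the energy function. Set r = max{q, p−q−s}, fix any a₁ > 1/(c(α−1)) and any M with 0 < M < min{3c/(4(2α−1)), c(α−1) − 1/a₁}. Then there exist a constant C₀ ≥ 0 and a time T ≥ t₀ such that for all t ≥ T, E'(t) + (M/t^r) E(t) ≤ C₀ (m(t) t^{3q+s+p−2} + m(t) t^{2q+s−p−1}). -/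
open Real Filter Asymptotics
open scoped RealInnerProductSpace Topology

theorem convexOn_gradient_inequality {X : Type*} [NormedAddCommGroup X] [InnerProductSpace ℝ X]
    [CompleteSpace X] {f : X → ℝ} {g u : X} (hconv : ConvexOn ℝ Set.univ f)
    (hf : HasGradientAt f g u) (y : X) : f u + ⟪g, y - u⟫ ≤ f y := by
  have hline : HasDerivAt (fun τ : ℝ => u + τ • (y - u)) (y - u) 0 := by
    simpa using ((hasDerivAt_id (0 : ℝ)).smul_const (y - u)).const_add u
  have hcomp : HasDerivAt (fun τ : ℝ => f (u + τ • (y - u))) ⟪g, y - u⟫ 0 := by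
    have h0 : HasFDerivAt f (InnerProductSpace.toDual ℝ X g) (u + (0 : ℝ) • (y - u)) := by
      simpa using hf.hasFDerivAt
    have := h0.comp_hasDerivAt (0 : ℝ) hline
    rwa [InnerProductSpace.toDual_apply_apply] at this
  have hc : ConvexOn ℝ Set.univ (fun τ : ℝ => f (u + τ • (y - u))) := by
    have := hconv.comp_affineMap (AffineMap.lineMap u y : ℝ →ᵃ[ℝ] X)
    simp only [Set.preimage_univ] at this
    refine this.congr fun τ _ => ?_
    simp [AffineMap.lineMap_apply, add_comm]
  have := hc.le_slope_of_hasDerivAt (Set.mem_univ 0) (Set.mem_univ 1) one_pos hcomp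
  simp [slope_def_field] at this
  linarith

theorem regularized_saddle_norm_bound
    {X Y : Type*} [NormedAddCommGroup X] [InnerProductSpace ℝ X] [CompleteSpace X]
    [NormedAddCommGroup Y] [InnerProductSpace ℝ Y] [CompleteSpace Y]
    {f : X → ℝ} {f' : X → X} (hf : ∀ u, HasGradientAt f (f' u) u)
    (hconv : ConvexOn ℝ Set.univ f) (A : X →L[ℝ] Y) (b : Y) {xs u : X} {ls v : Y} {k : ℝ}
    (hk : 0 < k)
    (hs : ∀ y μ, f xs + ⟪μ, A xs - b⟫ ≤ f xs + ⟪ls, A xs - b⟫ ∧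
      f xs + ⟪ls, A xs - b⟫ ≤ f y + ⟪ls, A y - b⟫)
    (hu : f' u + ContinuousLinearMap.adjoint A v + k • u = 0) (hv : A u - b - k • v = 0) :
    ‖u‖ ^ 2 + ‖v‖ ^ 2 ≤ ‖xs‖ ^ 2 + ‖ls‖ ^ 2 := by
  have hAb : A xs - b = 0 := by
    have h := (hs xs (ls + (A xs - b))).1
    rw [inner_add_left, real_inner_self_eq_norm_sq] at h
    have : ‖A xs - b‖ ^ 2 = 0 := le_antisymm (by linarith) (sq_nonneg _)
    simpa using this
  have hfeas : A u - b = k • v := sub_eq_zero.1 hv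
  have h1 := (hs u ls).2
  rw [hAb, hfeas, inner_zero_right, inner_smul_right] at h1
  have h2 := convexOn_gradient_inequality hconv (hf u) xs
  have hg : f' u = -(ContinuousLinearMap.adjoint A v + k • u) :=
    eq_neg_of_add_eq_zero_left (by rw [← hu, add_assoc])
  have hA : A (xs - u) = -(k • v) := by
    rw [map_sub, ← hfeas, sub_eq_zero.1 hAb]; abel
  rw [hg, inner_neg_left, inner_add_left, ContinuousLinearMap.adjoint_inner_left, hA,
    inner_neg_right, inner_smul_right, inner_smul_left, inner_sub_right,
    real_inner_self_eq_norm_sq, real_inner_self_eq_norm_sq] at h2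
  simp only [conj_trivial] at h2
  have h3 : k * (‖u‖ ^ 2 + ‖v‖ ^ 2) ≤ k * (⟪u, xs⟫ + ⟪ls, v⟫) := by linarith
  have h4 := le_of_mul_le_mul_left h3 hk
  have h5 := real_inner_le_norm u xs
  have h6 := real_inner_le_norm ls v
  nlinarith [sq_nonneg (‖u‖ - ‖xs‖), sq_nonneg (‖v‖ - ‖ls‖)]

theorem regularized_saddle_deriv_bound
    {X Y : Type*} [NormedAddCommGroup X] [InnerProductSpace ℝ X] [CompleteSpace X]
    [NormedAddCommGroup Y] [InnerProductSpace ℝ Y] [CompleteSpace Y]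
    {f : X → ℝ} {f' : X → X} (hf : ∀ u, HasGradientAt f (f' u) u)
    (hconv : ConvexOn ℝ Set.univ f) (A : X →L[ℝ] Y) (b : Y)
    {xt : ℝ → X} {lt : ℝ → Y} {k : ℝ → ℝ} {t k' : ℝ} {xt' : X} {lt' : Y}
    (hxt : HasDerivAt xt xt' t) (hlt : HasDerivAt lt lt' t) (hk : HasDerivAt k k' t)
    (hs : ∀ᶠ τ in 𝓝 t, f' (xt τ) + ContinuousLinearMap.adjoint A (lt τ) + k τ • xt τ = 0 ∧
      A (xt τ) - b - k τ • lt τ = 0) :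
    k t * (‖xt'‖ ^ 2 + ‖lt'‖ ^ 2) ≤ -k' * (⟪xt', xt t⟫ + ⟪lt', lt t⟫) := by
  have hmono : ∀ u v, 0 ≤ ⟪f' u - f' v, u - v⟫ := fun u v => by
    have h1 := convexOn_gradient_inequality hconv (hf u) v
    have h2 := convexOn_gradient_inequality hconv (hf v) u
    rw [← neg_sub u v, inner_neg_right] at h1
    rw [inner_sub_left]
    linarith
  have hlim : Tendsto (fun τ => ⟪slope xt t τ, slope (fun τ => k τ • xt τ) t τ⟫ +
      ⟪slope lt t τ, slope (fun τ => k τ • lt τ) t τ⟫) (𝓝[≠] t)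
      (𝓝 (⟪xt', k t • xt' + k' • xt t⟫ + ⟪lt', k t • lt' + k' • lt t⟫)) :=
    ((hasDerivAt_iff_tendsto_slope.1 hxt).inner
      (hasDerivAt_iff_tendsto_slope.1 (hk.smul hxt))).add
    ((hasDerivAt_iff_tendsto_slope.1 hlt).inner (hasDerivAt_iff_tendsto_slope.1 (hk.smul hlt)))
  have hle : ∀ᶠ τ in 𝓝[≠] t, ⟪slope xt t τ, slope (fun τ => k τ • xt τ) t τ⟫ +
      ⟪slope lt t τ, slope (fun τ => k τ • lt τ) t τ⟫ ≤ 0 := by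
    filter_upwards [nhdsWithin_le_nhds hs] with τ hτ
    obtain ⟨hx0, hl0⟩ := hs.self_of_nhds
    obtain ⟨hxτ, hlτ⟩ := hτ
    have hdx : k τ • xt τ - k t • xt t =
        -(f' (xt τ) - f' (xt t)) - ContinuousLinearMap.adjoint A (lt τ - lt t) := by
      rw [map_sub, eq_neg_of_add_eq_zero_right hxτ, eq_neg_of_add_eq_zero_right hx0]; abel
    have hdl : k τ • lt τ - k t • lt t = A (xt τ - xt t) := by
      rw [map_sub, ← sub_eq_zero.1 hlτ, ← sub_eq_zero.1 hl0]; abel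
    have hm := hmono (xt τ) (xt t)
    have hsum : ⟪xt τ - xt t, k τ • xt τ - k t • xt t⟫ +
        ⟪lt τ - lt t, k τ • lt τ - k t • lt t⟫ ≤ 0 := by
      rw [hdx, hdl, inner_sub_right, inner_neg_right, ContinuousLinearMap.adjoint_inner_right,
        real_inner_comm _ (xt τ - xt t), real_inner_comm (A _) (lt τ - lt t)]
      linarith
    simp only [slope_def_module, inner_smul_left, inner_smul_right, conj_trivial]
    nlinarith [mul_nonneg (sq_nonneg (τ - t)⁻¹) (neg_nonneg.2 hsum)]
  have := le_of_tendsto hlim hle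
  simp only [inner_add_right, inner_smul_right, real_inner_self_eq_norm_sq] at this
  linarith

theorem norm_bound_of_sq_le_inner
    {X Y : Type*} [NormedAddCommGroup X] [InnerProductSpace ℝ X]
    [NormedAddCommGroup Y] [InnerProductSpace ℝ Y] {x' x : X} {y' y : Y} {ρ K : ℝ}
    (hρ : 0 ≤ ρ) (hK : 0 ≤ K) (hxy : ‖x‖ ^ 2 + ‖y‖ ^ 2 ≤ K ^ 2)
    (h : ‖x'‖ ^ 2 + ‖y'‖ ^ 2 ≤ ρ * (⟪x', x⟫ + ⟪y', y⟫)) :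
    ‖x'‖ ≤ ρ * K ∧ ‖y'‖ ≤ ρ * K := by
  have h1 := real_inner_le_norm x' x
  have h2 := real_inner_le_norm y' y
  have h3 : ‖x'‖ ^ 2 + ‖y'‖ ^ 2 ≤ ‖x'‖ * (ρ * ‖x‖) + ‖y'‖ * (ρ * ‖y‖) := by
    nlinarith [mul_le_mul_of_nonneg_left (add_le_add h1 h2) hρ]
  have h4 : ‖x'‖ ^ 2 + ‖y'‖ ^ 2 ≤ (ρ * K) ^ 2 := by
    nlinarith [sq_nonneg (‖x'‖ - ρ * ‖x‖), sq_nonneg (‖y'‖ - ρ * ‖y‖),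
      mul_le_mul_of_nonneg_left hxy (sq_nonneg ρ)]
  have h5 : 0 ≤ ρ * K := mul_nonneg hρ hK
  exact ⟨abs_le_of_sq_le_sq' (by nlinarith [sq_nonneg ‖y'‖]) h5 |>.2,
    abs_le_of_sq_le_sq' (by nlinarith [sq_nonneg ‖x'‖]) h5 |>.2⟩

theorem lagrangian_gap_hasDerivAt
    {X Y : Type*} [NormedAddCommGroup X] [InnerProductSpace ℝ X] [CompleteSpace X]
    [NormedAddCommGroup Y] [InnerProductSpace ℝ Y] [CompleteSpace Y]
    {f : X → ℝ} {f' : X → X} (hf : ∀ u, HasGradientAt f (f' u) u) (A : X →L[ℝ] Y) (b : Y)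
    {x xt : ℝ → X} {lt : ℝ → Y} {k : ℝ → ℝ} {t k' : ℝ} {x' xt' : X} {lt' : Y}
    (hx : HasDerivAt x x' t) (hxt : HasDerivAt xt xt' t) (hlt : HasDerivAt lt lt' t)
    (hk : HasDerivAt k k' t)
    (hsx : f' (xt t) + ContinuousLinearMap.adjoint A (lt t) + k t • xt t = 0) :
    HasDerivAt (fun τ => (f (x τ) + ⟪lt τ, A (x τ) - b⟫ + k τ / 2 * (‖x τ‖ ^ 2 - ‖lt τ‖ ^ 2)) -
        (f (xt τ) + ⟪lt τ, A (xt τ) - b⟫ + k τ / 2 * (‖xt τ‖ ^ 2 - ‖lt τ‖ ^ 2)))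
      (⟪f' (x t) + ContinuousLinearMap.adjoint A (lt t) + k t • x t, x'⟫ +
        ⟪lt', A (x t - xt t)⟫ + k' / 2 * (‖x t‖ ^ 2 - ‖xt t‖ ^ 2)) t := by
  have key : ∀ {y : ℝ → X} {y' : X}, HasDerivAt y y' t →
      HasDerivAt (fun τ => f (y τ) + ⟪lt τ, A (y τ) - b⟫ + k τ / 2 * (‖y τ‖ ^ 2 - ‖lt τ‖ ^ 2))
        (⟪f' (y t) + ContinuousLinearMap.adjoint A (lt t) + k t • y t, y'⟫ + ⟪lt', A (y t) - b⟫
          + k' / 2 * (‖y t‖ ^ 2 - ‖lt t‖ ^ 2) - k t * ⟪lt t, lt'⟫) t := by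
    intro y y' hy
    have h1 : HasDerivAt (fun τ => f (y τ)) ⟪f' (y t), y'⟫ t := by
      have := (hf (y t)).hasFDerivAt.comp_hasDerivAt t hy
      rwa [InnerProductSpace.toDual_apply_apply] at this
    have h2 := hlt.inner ℝ ((A.hasFDerivAt.comp_hasDerivAt t hy).sub_const b)
    have h3 := (hk.div_const 2).mul (hy.norm_sq.sub hlt.norm_sq)
    refine ((h1.add h2).add h3).congr_deriv ?_
    simp only [inner_add_left, inner_smul_left, conj_trivial,
      ContinuousLinearMap.adjoint_inner_left, Function.comp_apply, Pi.sub_apply]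
    ring
  refine ((key hx).sub (key hxt)).congr_deriv ?_
  rw [hsx, inner_zero_left, map_sub, inner_sub_right, inner_sub_right, inner_sub_right]
  ring

theorem lagrangian_gap_bounds
    {X Y : Type*} [NormedAddCommGroup X] [InnerProductSpace ℝ X] [CompleteSpace X]
    [NormedAddCommGroup Y] [InnerProductSpace ℝ Y] [CompleteSpace Y]
    {f : X → ℝ} {f' : X → X} (hf : ∀ u, HasGradientAt f (f' u) u)
    (hconv : ConvexOn ℝ Set.univ f) (A : X →L[ℝ] Y) (b : Y) (u : X) {v : X} {μ : Y} {k ψ : ℝ}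
    (hk : 0 ≤ k) (hv : f' v + ContinuousLinearMap.adjoint A μ + k • v = 0)
    (hψ : ψ = (f u + ⟪μ, A u - b⟫ + k / 2 * (‖u‖ ^ 2 - ‖μ‖ ^ 2)) -
        (f v + ⟪μ, A v - b⟫ + k / 2 * (‖v‖ ^ 2 - ‖μ‖ ^ 2))) :
    0 ≤ ψ ∧ ψ + k / 2 * ‖u - v‖ ^ 2 ≤
      ⟪u - v, f' u + ContinuousLinearMap.adjoint A μ + k • u⟫ := by
  have strong : ∀ y z, f y + ⟪μ, A y - b⟫ + k / 2 * ‖y‖ ^ 2 +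
      ⟪z - y, f' y + ContinuousLinearMap.adjoint A μ + k • y⟫ + k / 2 * ‖z - y‖ ^ 2 ≤
      f z + ⟪μ, A z - b⟫ + k / 2 * ‖z‖ ^ 2 := fun y z => by
    have h := convexOn_gradient_inequality hconv (hf y) z
    rw [real_inner_comm] at h
    simp only [norm_sub_sq_real, inner_add_right, ContinuousLinearMap.adjoint_inner_right,
      inner_smul_right, real_inner_comm μ, map_sub, inner_sub_right, inner_sub_left,
      real_inner_self_eq_norm_sq] at h ⊢
    linarith
  have h1 := strong v u
  have h2 := strong u v
  rw [hv, inner_zero_right] at h1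
  rw [← neg_sub u v, inner_neg_left, norm_neg] at h2
  have : 0 ≤ k / 2 * ‖u - v‖ ^ 2 := by positivity
  constructor <;> linarith

theorem energy_derivative_identity
    {X Y : Type*} [NormedAddCommGroup X] [InnerProductSpace ℝ X] [CompleteSpace X]
    [NormedAddCommGroup Y] [InnerProductSpace ℝ Y] [CompleteSpace Y] (A : X →L[ℝ] Y)
    (z x' xt' G₀ G : X) (η lt' : Y) {α β w a Q m γ k : ℝ}
    (hG : G = G₀ + ContinuousLinearMap.adjoint A η) (ha : a = w * m + γ * β) :
    a * Q * ⟪G₀, x'⟫ +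
        ⟪(α - 1) • z + Q • (m • x' + γ • G), -(β • x') - (α - 1) • xt' - w • G⟫ +
        (α - 1) * β * ⟪z, x' - xt'⟫ +
        ⟪η, ((α - 1) * w) • (A z - k • η) + (a * Q) • A x' - lt'⟫ =
      -((α - 1) ^ 2 + (α - 1) * β) * ⟪z, xt'⟫ - (α - 1) * w * ⟪z, G₀⟫ - β * Q * m * ‖x'‖ ^ 2
        - (α - 1) * Q * m * ⟪x', xt'⟫ - γ * (α - 1) * Q * ⟪G, xt'⟫ - γ * Q * w * ‖G‖ ^ 2
        - (α - 1) * w * k * ‖η‖ ^ 2 - ⟪η, lt'⟫ := by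
  have h1 : ⟪G₀, x'⟫ = ⟪G, x'⟫ - ⟪η, A x'⟫ := by
    rw [hG, inner_add_left, ContinuousLinearMap.adjoint_inner_left]; ring
  have h2 : ⟪z, G₀⟫ = ⟪z, G⟫ - ⟪η, A z⟫ := by
    rw [hG, inner_add_right, ContinuousLinearMap.adjoint_inner_right, real_inner_comm η]; ring
  rw [h1, h2, ha]
  simp only [inner_add_left, inner_add_right, inner_sub_right, inner_neg_right, inner_smul_left,
    inner_smul_right, conj_trivial, real_inner_self_eq_norm_sq, real_inner_comm G x']
  ring

theorem neg_mul_sq_add_mul_le {A B y : ℝ} (hA : 0 < A) : -A * y ^ 2 + B * y ≤ B ^ 2 / A := by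
  rw [le_div_iff₀ hA]
  nlinarith [sq_nonneg (2 * A * y - B), sq_nonneg B]

/-! In the scalar estimates below `Q`, `S`, `P`, `R` stand for `t ^ q`, `t ^ s`, `t ^ p` and
`(t ^ r)⁻¹`. -/

theorem inv_weight_le {Q S P t m γ : ℝ} (hQ : 1 ≤ Q) (hS : 1 ≤ S) (hP : 1 ≤ P) (ht : 1 ≤ t)
    (hm : 0 < m) (hγ : 0 < γ) (hγm : γ ≤ m * (Q * S)) :
    P / (Q * S * t ^ 2) ≤ m * (Q ^ 3 * S * P / t ^ 2) / γ := by
  rw [div_le_div_iff₀ (by positivity) hγ]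
  have h1 : (1 : ℝ) ≤ Q ^ 3 * S := one_le_mul_of_one_le_of_one_le (one_le_pow₀ hQ) hS
  calc P * γ ≤ P * (m * (Q * S)) * 1 := by rw [mul_one]; gcongr
    _ ≤ P * (m * (Q * S)) * (Q ^ 3 * S) := by gcongr
    _ = m * (Q ^ 3 * S * P / t ^ 2) * (Q * S * t ^ 2) := by field_simp

theorem weight_div_sq_le {Q S P t m : ℝ} (hQ : 1 ≤ Q) (hS : 1 ≤ S) (hP : 1 ≤ P) (hm : 0 < m) :
    m * (Q / t ^ 2) ≤ m * (Q ^ 3 * S * P / t ^ 2) := by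
  gcongr
  have h : (1 : ℝ) ≤ Q ^ 2 * S * P := one_le_mul_of_one_le_of_one_le
    (one_le_mul_of_one_le_of_one_le (one_le_pow₀ hQ) hS) hP
  calc Q = Q * 1 := (mul_one Q).symm
    _ ≤ Q * (Q ^ 2 * S * P) := by gcongr
    _ = _ := by ring

theorem gap_term_nonpos {α Q S R M w a S' ψ : ℝ} (hα : 0 < α - 1) (hQS : 0 < Q * S)
    (hw : 15 / 16 * (Q * S) ≤ w) (hS' : S' ≤ (α - 1) / 4 * (Q * S))
    (hMa : M * R * a * Q ≤ (α - 1) / 2 * (Q * S)) (hψ : 0 ≤ ψ) :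
    (S' - (α - 1) * w + M * R * a * Q) * ψ ≤ 0 := by
  refine mul_nonpos_of_nonpos_of_nonneg ?_ hψ
  have h1 := mul_le_mul_of_nonneg_left hw hα.le
  have h2 := mul_pos hα hQS
  linarith

theorem distance_term_le {c α u R P M w β b' : ℝ} (hc : 0 < c) (hα : 1 < α) (hR : 0 < R)
    (hM : 0 < M) (hM' : M * (4 * (2 * α - 1)) ≤ 3 * c) (hRu : R ≤ u)
    (hwu : 15 / 16 * u ≤ w / P) (hβ' : β ≤ 17 / 16) (hb' : |b'| ≤ c * (α - 1) * u / 64) :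
    -((α - 1) * w * (c / P / 2)) + 1 / 2 * b' + M * R * ((α - 1) ^ 2 + 1 / 2 * ((α - 1) * β)) ≤
      -(c * (α - 1) * u / 16) := by
  have hα' : 0 < α - 1 := by linarith
  have e1 : c * (α - 1) / 2 * (15 / 16 * u) ≤ c * (α - 1) / 2 * (w / P) := by gcongr
  have e1' : (α - 1) * w * (c / P / 2) = c * (α - 1) / 2 * (w / P) := by ring
  have e2 : b' ≤ c * (α - 1) * u / 64 := (le_abs_self _).trans hb'
  have e3 : M * R * ((α - 1) ^ 2 + 1 / 2 * ((α - 1) * β)) ≤ 51 / 128 * (c * (α - 1)) * u := by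
    have f1 : (α - 1) ^ 2 + 1 / 2 * ((α - 1) * β) ≤ 17 / 32 * ((α - 1) * (2 * α - 1)) := by
      nlinarith [mul_le_mul_of_nonneg_left hβ' hα'.le, mul_pos hα' hα']
    calc M * R * ((α - 1) ^ 2 + 1 / 2 * ((α - 1) * β))
        ≤ M * R * (17 / 32 * ((α - 1) * (2 * α - 1))) := by gcongr
      _ = 17 / 128 * (α - 1) * R * (M * (4 * (2 * α - 1))) := by ring
      _ ≤ 17 / 128 * (α - 1) * R * (3 * c) := by gcongr
      _ = 51 / 128 * (c * (α - 1)) * R := by ring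
      _ ≤ 51 / 128 * (c * (α - 1)) * u := by gcongr
  linarith

theorem distance_error_le {α t Q S m a β K nA Z : ℝ} (hα : 1 < α) (ht : 0 < t) (hQ : 0 < Q)
    (ha : a ≤ 3 * m * (Q * S)) (hβ' : β ≤ 17 / 16) (hK : 0 ≤ K) (hnA : 0 ≤ nA) (hZ : 0 ≤ Z) :
    a * Q * (nA * (K / t) * Z) + ((α - 1) ^ 2 + (α - 1) * β) * (K / t * Z) ≤
      (3 * (nA * K) * (m * (Q ^ 2 * S)) + ((α - 1) ^ 2 + 2 * (α - 1)) * K) / t * Z := by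
  have hα' : 0 < α - 1 := by linarith
  have e1 : a * Q * (nA * (K / t) * Z) ≤ 3 * m * (Q * S) * Q * (nA * (K / t) * Z) := by gcongr
  have e2 : ((α - 1) ^ 2 + (α - 1) * β) * (K / t * Z) ≤
      ((α - 1) ^ 2 + (α - 1) * 2) * (K / t * Z) := by
    gcongr; linarith
  refine (add_le_add e1 e2).trans (le_of_eq ?_)
  field_simp

theorem distance_error_sq_div_le {t Q S P m γ k₁ e b : ℝ} (hQ : 1 ≤ Q) (hS : 1 ≤ S)
    (hP : 1 ≤ P) (ht : 1 ≤ t) (hm : 0 < m) (hγ : 0 < γ) (hγm : γ ≤ m * (Q * S)) (hmk : m ≤ k₁) :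
    ((3 * e * (m * (Q ^ 2 * S)) + b) / t) ^ 2 / (Q * S / P) ≤
      2 * (9 * e ^ 2 * k₁ + b ^ 2 / γ) * (m * (Q ^ 3 * S * P / t ^ 2)) := by
  have hinv := inv_weight_le hQ hS hP ht hm hγ hγm
  have e1 : ((3 * e * (m * (Q ^ 2 * S)) + b) / t) ^ 2 ≤
      2 * ((3 * e * (m * (Q ^ 2 * S))) ^ 2 + b ^ 2) / t ^ 2 := by
    rw [div_pow]; gcongr
    exact add_sq_le
  calc _ ≤ 2 * ((3 * e * (m * (Q ^ 2 * S))) ^ 2 + b ^ 2) / t ^ 2 / (Q * S / P) := by gcongr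
    _ = 2 * (9 * e ^ 2 * m * (m * (Q ^ 3 * S * P / t ^ 2)) + b ^ 2 * (P / (Q * S * t ^ 2))) := by
      field_simp; ring
    _ ≤ 2 * (9 * e ^ 2 * k₁ * (m * (Q ^ 3 * S * P / t ^ 2)) +
        b ^ 2 * (m * (Q ^ 3 * S * P / t ^ 2) / γ)) := by gcongr
    _ = _ := by ring

theorem velocity_term_le {Q R M m β : ℝ} (hQ : 0 < Q) (hm : 0 < m) (hM : 0 < M)
    (hRQ : R * Q ≤ 1) (hMm : 8 * M * m ≤ 1) (hβ : 1 / 2 ≤ β) :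
    -(β * Q * m) + M * R * (2 * Q ^ 2 * m ^ 2) ≤ -(Q * m / 4) := by
  have e1 : M * R * (2 * Q ^ 2 * m ^ 2) = (R * Q) * ((8 * M * m) * (Q * m / 4)) := by ring
  have e2 : (R * Q) * ((8 * M * m) * (Q * m / 4)) ≤ 1 * (1 * (Q * m / 4)) := by gcongr
  have e3 : 1 / 2 * (Q * m) ≤ β * (Q * m) := by gcongr
  linarith

theorem velocity_error_le {α t Q S P m K V : ℝ} (hQ : 1 ≤ Q) (hS : 1 ≤ S) (hP : 1 ≤ P)
    (hm : 0 < m) (ht : 0 < t) :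
    -(Q * m / 4) * V ^ 2 + (α - 1) * Q * m * (K / t) * V ≤
      4 * (α - 1) ^ 2 * K ^ 2 * (m * (Q ^ 3 * S * P / t ^ 2)) := by
  refine (neg_mul_sq_add_mul_le (by positivity)).trans ?_
  calc ((α - 1) * Q * m * (K / t)) ^ 2 / (Q * m / 4)
      = 4 * (α - 1) ^ 2 * K ^ 2 * (m * (Q / t ^ 2)) := by field_simp
    _ ≤ _ := mul_le_mul_of_nonneg_left (weight_div_sq_le hQ hS hP hm) (by positivity)

theorem gradient_term_le {Q S R M γ w : ℝ} (hQ : 0 < Q) (hQS : 0 < Q * S)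
    (hγ : 0 < γ) (hM : 0 < M) (hRQ : R * Q ≤ 1) (hMγ : 4 * M * γ ≤ Q * S)
    (hw : 15 / 16 * (Q * S) ≤ w) :
    -(γ * Q * w) + M * R * (2 * Q ^ 2 * γ ^ 2) ≤ -(γ * Q * (Q * S) / 4) := by
  have e1 : M * R * (2 * Q ^ 2 * γ ^ 2) = (R * Q) * ((4 * M * γ) * (Q * γ / 2)) := by ring
  have e2 : (R * Q) * ((4 * M * γ) * (Q * γ / 2)) ≤ 1 * ((Q * S) * (Q * γ / 2)) := by gcongr
  have e3 : γ * Q * (15 / 16 * (Q * S)) ≤ γ * Q * w := by gcongr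
  have e4 := mul_pos (mul_pos hγ hQ) hQS
  linarith

theorem gradient_error_le {α t Q S P m γ K g : ℝ} (hQ : 1 ≤ Q) (hS : 1 ≤ S) (hP : 1 ≤ P)
    (hm : 0 < m) (ht : 0 < t) (hγ : 0 < γ) (hγm : γ ≤ m * (Q * S)) :
    -(γ * Q * (Q * S) / 4) * g ^ 2 + γ * (α - 1) * Q * (K / t) * g ≤
      4 * (α - 1) ^ 2 * K ^ 2 * (m * (Q ^ 3 * S * P / t ^ 2)) := by
  refine (neg_mul_sq_add_mul_le (by positivity)).trans ?_
  have e1 : γ * (1 / (S * t ^ 2)) ≤ m * (Q ^ 3 * S * P / t ^ 2) := by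
    calc γ * (1 / (S * t ^ 2)) ≤ m * (Q * S) * (1 / (S * t ^ 2)) := by gcongr
      _ = m * (Q / t ^ 2) := by field_simp
      _ ≤ _ := weight_div_sq_le hQ hS hP hm
  calc (γ * (α - 1) * Q * (K / t)) ^ 2 / (γ * Q * (Q * S) / 4)
      = 4 * (α - 1) ^ 2 * K ^ 2 * (γ * (1 / (S * t ^ 2))) := by field_simp
    _ ≤ _ := by gcongr

theorem multiplier_term_le {c α u R P M w : ℝ} (hδ : 0 < c * (α - 1)) (hu : 0 < u) (hR : 0 < R)
    (hM'' : M ≤ c * (α - 1)) (hRu : R ≤ u) (hwu : 15 / 16 * u ≤ w / P) :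
    -((α - 1) * w * (c / P)) + M * R * (1 / 2) ≤ -(c * (α - 1) * u / 4) := by
  have e1 : (α - 1) * w * (c / P) = c * (α - 1) * (w / P) := by ring
  have e2 : c * (α - 1) * (15 / 16 * u) ≤ c * (α - 1) * (w / P) := by gcongr
  have e3 : M * R ≤ c * (α - 1) * u := by gcongr
  have e4 := mul_pos hδ hu
  linarith

theorem multiplier_error_le {δ t Q S P m γ K H : ℝ} (hδ : 0 < δ) (hQ : 1 ≤ Q) (hS : 1 ≤ S)
    (hP : 1 ≤ P) (ht : 1 ≤ t) (hm : 0 < m) (hγ : 0 < γ) (hγm : γ ≤ m * (Q * S)) :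
    -(δ * (Q * S / P) / 4) * H ^ 2 + K / t * H ≤
      4 * K ^ 2 / (δ * γ) * (m * (Q ^ 3 * S * P / t ^ 2)) := by
  have hinv := inv_weight_le hQ hS hP ht hm hγ hγm
  refine (neg_mul_sq_add_mul_le (by positivity)).trans ?_
  calc (K / t) ^ 2 / (δ * (Q * S / P) / 4) = 4 * K ^ 2 / δ * (P / (Q * S * t ^ 2)) := by
        field_simp
    _ ≤ 4 * K ^ 2 / δ * (m * (Q ^ 3 * S * P / t ^ 2) / γ) := by gcongr
    _ = _ := by field_simp

theorem energy_scalar_estimate {c p α γ k₁ M K nA : ℝ} (hc : 0 < c) (hp : 0 < p) (hα : 1 < α)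
    (hγ : 0 < γ) (hk₁ : 0 < k₁) (hM : 0 < M) (hM' : M * (4 * (2 * α - 1)) ≤ 3 * c)
    (hM'' : M ≤ c * (α - 1)) (hK : 0 ≤ K) (hnA : 0 ≤ nA) :
    ∃ C₀ ≥ (0 : ℝ), ∀ t Q S P R m w a β S' b' ψ Z V g H : ℝ, 1 ≤ t → 1 ≤ Q → 1 ≤ S → 1 ≤ P →
      0 < m → 0 < R → R ≤ Q⁻¹ → R ≤ Q * S / P → γ ≤ m * (Q * S) → m ≤ k₁ →
      8 * M * m ≤ 1 → 4 * M * γ ≤ Q * S →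
      15 / 16 * (Q * S) ≤ w → a ≤ 3 * m * (Q * S) →
      S' ≤ (α - 1) / 4 * (Q * S) → M * R * a * Q ≤ (α - 1) / 2 * (Q * S) →
      1 / 2 ≤ β → β ≤ 17 / 16 → |b'| ≤ c * (α - 1) * (Q * S / P) / 64 →
      0 ≤ ψ → 0 ≤ Z →
      S' * ψ - (α - 1) * w * (ψ + c / P / 2 * Z ^ 2) + a * Q * (nA * (K / t) * Z) +
        a * Q * (c * p / (P * t) / 2 * K ^ 2) + ((α - 1) ^ 2 + (α - 1) * β) * (K / t * Z) -
        β * Q * m * V ^ 2 + (α - 1) * Q * m * (K / t * V) + γ * (α - 1) * Q * (K / t * g) -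
        γ * Q * w * g ^ 2 + 1 / 2 * b' * Z ^ 2 - (α - 1) * w * (c / P) * H ^ 2 + K / t * H +
        M * R * (a * Q * ψ + ((α - 1) ^ 2 * Z ^ 2 + 2 * Q ^ 2 * (m ^ 2 * V ^ 2 + γ ^ 2 * g ^ 2)) +
          1 / 2 * ((α - 1) * β) * Z ^ 2 + 1 / 2 * H ^ 2) ≤
      C₀ * (m * (Q ^ 3 * S * P / t ^ 2) + m * (Q ^ 2 * S / (P * t))) := by
  have hα' : 0 < α - 1 := by linarith
  have hδ0 : 0 < c * (α - 1) := by positivity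
  obtain ⟨b₂, hb₂⟩ : ∃ b₂, b₂ = ((α - 1) ^ 2 + 2 * (α - 1)) * K := ⟨_, rfl⟩
  obtain ⟨C₁, hC₁⟩ : ∃ C, C = 16 / (c * (α - 1)) * (2 * (9 * (nA * K) ^ 2 * k₁ + b₂ ^ 2 / γ)) :=
    ⟨_, rfl⟩
  obtain ⟨C₂, hC₂⟩ : ∃ C, C = 4 * (α - 1) ^ 2 * K ^ 2 := ⟨_, rfl⟩
  obtain ⟨C₃, hC₃⟩ : ∃ C, C = 4 * K ^ 2 / (c * (α - 1) * γ) := ⟨_, rfl⟩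
  obtain ⟨C₄, hC₄⟩ : ∃ C, C = 3 * c * p * K ^ 2 / 2 := ⟨_, rfl⟩
  have hC₁0 : 0 ≤ C₁ := by rw [hC₁]; positivity
  have hC₂0 : 0 ≤ C₂ := by rw [hC₂]; positivity
  have hC₃0 : 0 ≤ C₃ := by rw [hC₃]; positivity
  have hC₄0 : 0 ≤ C₄ := by rw [hC₄]; positivity
  refine ⟨C₁ + C₂ + C₂ + C₃ + C₄, by positivity, ?_⟩
  intro t Q S P R m w a β S' b' ψ Z V g H ht hQ hS hP hm hR hRQ hRu hγm hmk hMm hMγ hw ha hS'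
    hMa hβ hβ' hb' hψ hZ
  have ht0 : 0 < t := by linarith
  have hQ0 : 0 < Q := by linarith
  have hP0 : 0 < P := by linarith
  have hQS : 0 < Q * S := by positivity
  have hu0 : 0 < Q * S / P := by positivity
  have hRQ1 : R * Q ≤ 1 := by
    calc R * Q ≤ Q⁻¹ * Q := by gcongr
      _ = 1 := inv_mul_cancel₀ hQ0.ne'
  have hwu : 15 / 16 * (Q * S / P) ≤ w / P := by
    rw [← mul_div_assoc]; gcongr
  have hgap := gap_term_nonpos hα' hQS hw hS' hMa hψ
  have hZ1 := mul_le_mul_of_nonneg_right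
    (distance_term_le hc hα hR hM hM' hRu hwu hβ' hb') (sq_nonneg Z)
  have hZ2 := distance_error_le hα ht0 hQ0 ha hβ' hK hnA hZ
  have hZ3 := neg_mul_sq_add_mul_le (A := c * (α - 1) * (Q * S / P) / 16)
    (B := (3 * (nA * K) * (m * (Q ^ 2 * S)) + ((α - 1) ^ 2 + 2 * (α - 1)) * K) / t) (y := Z)
    (by positivity)
  have hZ4 := distance_error_sq_div_le (e := nA * K) (b := b₂) hQ hS hP ht hm hγ hγm hmk
  rw [← hb₂] at hZ2 hZ3
  have hZ5 : ((3 * (nA * K) * (m * (Q ^ 2 * S)) + b₂) / t) ^ 2 /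
      (c * (α - 1) * (Q * S / P) / 16) ≤ C₁ * (m * (Q ^ 3 * S * P / t ^ 2)) := by
    calc _ = 16 / (c * (α - 1)) *
          (((3 * (nA * K) * (m * (Q ^ 2 * S)) + b₂) / t) ^ 2 / (Q * S / P)) := by
            generalize Q * S / P = u
            generalize c * (α - 1) = δ
            field_simp
      _ ≤ _ := mul_le_mul_of_nonneg_left hZ4 (by positivity)
      _ = _ := by rw [hC₁]; ring
  have hV1 := mul_le_mul_of_nonneg_right
    (velocity_term_le hQ0 hm hM hRQ1 hMm hβ) (sq_nonneg V)
  have hV2 := velocity_error_le (α := α) (K := K) (V := V) hQ hS hP hm ht0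
  have hg1 := mul_le_mul_of_nonneg_right
    (gradient_term_le hQ0 hQS hγ hM hRQ1 hMγ hw) (sq_nonneg g)
  have hg2 := gradient_error_le (α := α) (K := K) (g := g) hQ hS hP hm ht0 hγ hγm
  have hH1 := mul_le_mul_of_nonneg_right
    (multiplier_term_le hδ0 hu0 hR hM'' hRu hwu) (sq_nonneg H)
  have hH2 := multiplier_error_le (K := K) (H := H) hδ0 hQ hS hP ht hm hγ hγm
  rw [← hC₂] at hV2 hg2
  rw [← hC₃] at hH2
  have hconst : a * Q * (c * p / (P * t) / 2 * K ^ 2) ≤ C₄ * (m * (Q ^ 2 * S / (P * t))) := by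
    calc a * Q * (c * p / (P * t) / 2 * K ^ 2)
        ≤ 3 * m * (Q * S) * Q * (c * p / (P * t) / 2 * K ^ 2) := by gcongr
      _ = _ := by rw [hC₄]; field_simp
  have hDD : 0 ≤ (C₁ + C₂ + C₂ + C₃) * (m * (Q ^ 2 * S / (P * t))) := by positivity
  have hDD' : 0 ≤ C₄ * (m * (Q ^ 3 * S * P / t ^ 2)) := by positivity
  generalize m * (Q ^ 2 * S / (P * t)) = D' at *
  generalize m * (Q ^ 3 * S * P / t ^ 2) = D at *
  clear hZ4 hC₁ hC₂ hC₃ hC₄ hb₂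
  generalize (3 * (nA * K) * (m * (Q ^ 2 * S)) + b₂) / t = B at *
  generalize a * Q * (nA * (K / t) * Z) = y₁ at *
  generalize ((α - 1) ^ 2 + (α - 1) * β) * (K / t * Z) = y₂ at *
  generalize a * Q * (c * p / (P * t) / 2 * K ^ 2) = y₃ at *
  generalize K / t = ρ at *
  linarith

theorem neg_inner_le_of_norm_le {X : Type*} [NormedAddCommGroup X] [InnerProductSpace ℝ X]
    {u v : X} {ρ : ℝ} (hv : ‖v‖ ≤ ρ) : -⟪u, v⟫ ≤ ρ * ‖u‖ := by
  have h1 := neg_le_of_abs_le (abs_real_inner_le_norm u v)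
  have h2 := mul_le_mul_of_nonneg_left hv (norm_nonneg u)
  linarith

theorem energy_derivative_le
    {X Y : Type*} [NormedAddCommGroup X] [InnerProductSpace ℝ X] [CompleteSpace X]
    [NormedAddCommGroup Y] [InnerProductSpace ℝ Y] [CompleteSpace Y] (A : X →L[ℝ] Y)
    {z x' xt' G₀ G : X} {η lt' : Y} {α β w a Q m γ k ρ ψ : ℝ}
    (hG : G = G₀ + ContinuousLinearMap.adjoint A η) (ha : a = w * m + γ * β)
    (hα : 0 ≤ α - 1) (hβ : 0 ≤ β) (hw : 0 ≤ w) (ha0 : 0 ≤ a) (hQ : 0 ≤ Q) (hm : 0 ≤ m)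
    (hγ : 0 ≤ γ) (hxt : ‖xt'‖ ≤ ρ) (hlt : ‖lt'‖ ≤ ρ)
    (hψ : ψ + k / 2 * ‖z‖ ^ 2 ≤ ⟪z, G₀⟫) :
    a * Q * (⟪G₀, x'⟫ + ⟪lt', A z⟫) +
        ⟪(α - 1) • z + Q • (m • x' + γ • G), -(β • x') - (α - 1) • xt' - w • G⟫ +
        (α - 1) * β * ⟪z, x' - xt'⟫ +
        ⟪η, ((α - 1) * w) • (A z - k • η) + (a * Q) • A x' - lt'⟫ ≤
      -(α - 1) * w * (ψ + k / 2 * ‖z‖ ^ 2) + a * Q * (‖A‖ * ρ * ‖z‖) +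
        ((α - 1) ^ 2 + (α - 1) * β) * (ρ * ‖z‖) - β * Q * m * ‖x'‖ ^ 2 +
        (α - 1) * Q * m * (ρ * ‖x'‖) + γ * (α - 1) * Q * (ρ * ‖G‖) - γ * Q * w * ‖G‖ ^ 2 -
        (α - 1) * w * k * ‖η‖ ^ 2 + ρ * ‖η‖ := by
  have hid := energy_derivative_identity A z x' xt' G₀ G η lt' (α := α) (Q := Q) (k := k) hG ha
  have h1 := mul_le_mul_of_nonneg_left (neg_inner_le_of_norm_le (u := z) hxt)
    (by positivity : 0 ≤ (α - 1) ^ 2 + (α - 1) * β)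
  have h2 := mul_le_mul_of_nonneg_left hψ (by positivity : 0 ≤ (α - 1) * w)
  have h3 := mul_le_mul_of_nonneg_left (neg_inner_le_of_norm_le (u := x') hxt)
    (by positivity : 0 ≤ (α - 1) * Q * m)
  have h4 := mul_le_mul_of_nonneg_left (neg_inner_le_of_norm_le (u := G) hxt)
    (by positivity : 0 ≤ γ * (α - 1) * Q)
  have h5 := neg_inner_le_of_norm_le (u := η) hlt
  have h6 : ⟪lt', A z⟫ ≤ ‖A‖ * ρ * ‖z‖ := by
    calc ⟪lt', A z⟫ ≤ ‖lt'‖ * ‖A z‖ := real_inner_le_norm _ _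
      _ ≤ ρ * (‖A‖ * ‖z‖) := mul_le_mul hlt (A.le_opNorm z) (norm_nonneg _)
          ((norm_nonneg _).trans hlt)
      _ = _ := by ring
  have h7 := mul_le_mul_of_nonneg_left h6 (mul_nonneg ha0 hQ)
  linarith

theorem half_norm_sq_velocity_le {X : Type*} [NormedAddCommGroup X] [InnerProductSpace ℝ X]
    (z x' G : X) (α Q m γ : ℝ) :
    1 / 2 * ‖(α - 1) • z + Q • (m • x' + γ • G)‖ ^ 2 ≤
      (α - 1) ^ 2 * ‖z‖ ^ 2 + 2 * Q ^ 2 * (m ^ 2 * ‖x'‖ ^ 2 + γ ^ 2 * ‖G‖ ^ 2) := by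
  have key : ∀ u v : X, ‖u + v‖ ^ 2 ≤ 2 * (‖u‖ ^ 2 + ‖v‖ ^ 2) := fun u v => by
    have := parallelogram_law_with_norm ℝ u v
    nlinarith [mul_self_nonneg ‖u - v‖]
  have h1 := key ((α - 1) • z) (Q • (m • x' + γ • G))
  have h2 := mul_le_mul_of_nonneg_left (key (m • x') (γ • G)) (sq_nonneg Q)
  simp only [norm_smul, mul_pow, norm_eq_abs, sq_abs] at h1 h2
  linarith

theorem mul_abs_rpow_bound {t Q m m₁ k₁ k₂ : ℝ} (ht : 0 < t) (hQ : 0 < Q) (hk₂ : 0 < k₂)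
    (hmQ : m * Q ≤ k₁) (h : t * |m₁| ≤ k₂ * m) : |m₁ * Q| ≤ k₁ * k₂ / t := by
  rw [le_div_iff₀ ht, abs_mul, abs_of_pos hQ]
  nlinarith [mul_le_mul_of_nonneg_right h hQ.le, mul_le_mul_of_nonneg_left hmQ hk₂.le]

theorem coeff_w_ge {γ q t Q S : ℝ} (ht : 1 ≤ t) (hQ : 1 ≤ Q) (hS : 1 ≤ S)
    (h : 16 * (γ * q) ≤ t) : 15 / 16 * (Q * S) ≤ Q * S - γ * q * (Q / t) := by
  have h1 : γ * q * (Q / t) ≤ Q / 16 := by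
    rw [← mul_div_assoc, div_le_iff₀ (by linarith)]
    nlinarith
  nlinarith

theorem coeff_beta_bounds {q t Q m m₁ k₁ k₂ : ℝ} (ht : 1 ≤ t) (hQ : 1 ≤ Q) (hm : 0 < m)
    (hq0 : 0 < q) (hq1 : q < 1) (hk₁ : 0 < k₁) (hk₂ : 0 < k₂)
    (hmQ : m * Q ≤ k₁) (hm₁ : t * |m₁| ≤ k₂ * m) (h1 : 32 * k₁ ≤ t) (h2 : 32 * (k₁ * k₂) ≤ t) :
    1 / 2 ≤ 1 - q * m * (Q / t) - m₁ * Q ∧ 1 - q * m * (Q / t) - m₁ * Q ≤ 17 / 16 := by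
  have ht0 : 0 < t := by linarith
  have e1 := abs_le.1 (mul_abs_rpow_bound ht0 (by linarith) hk₂ hmQ hm₁)
  have e2 : k₁ * k₂ / t ≤ 1 / 32 := by rw [div_le_iff₀ ht0]; linarith
  have e3 : q * m * (Q / t) ≤ 1 / 32 := by
    calc q * m * (Q / t) = q * (m * Q) / t := by ring
      _ ≤ 1 * k₁ / t := by gcongr
      _ ≤ 1 / 32 := by rw [div_le_iff₀ ht0]; linarith
  have e4 : 0 ≤ q * m * (Q / t) := by positivity
  constructor <;> linarith [e1.1, e1.2]

theorem coeff_a_bounds {γ q t Q S m m₁ k₂ : ℝ} (ht : 1 ≤ t) (hQ : 1 ≤ Q) (hS : 1 ≤ S)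
    (hm : 0 < m) (hγ : 0 < γ) (hq0 : 0 < q) (hm₁ : t * |m₁| ≤ k₂ * m) (hγm : γ ≤ m * (Q * S))
    (h1 : 16 * (γ * q) ≤ t) (h2 : 2 * (γ * k₂) ≤ t) :
    0 ≤ m * (Q * S) - 2 * γ * q * m * (Q / t) - γ * m₁ * Q + γ ∧
      m * (Q * S) - 2 * γ * q * m * (Q / t) - γ * m₁ * Q + γ ≤ 3 * m * (Q * S) := by
  have ht0 : 0 < t := by linarith
  have hQ0 : 0 < Q := by linarith
  have e0 : m * Q ≤ m * (Q * S) := by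
    have : Q * 1 ≤ Q * S := by gcongr
    gcongr; linarith
  have e1 : |γ * m₁ * Q| ≤ m * Q / 2 := by
    rw [abs_mul, abs_mul, abs_of_pos hγ, abs_of_pos hQ0]
    have : |m₁| ≤ k₂ * m / t := by rw [le_div_iff₀ ht0]; linarith
    calc γ * |m₁| * Q ≤ γ * (k₂ * m / t) * Q := by gcongr
      _ = (2 * (γ * k₂)) / t * (m * Q / 2) := by ring
      _ ≤ 1 * (m * Q / 2) := by gcongr; rwa [div_le_one ht0]
      _ = _ := one_mul _
  have e2 : 2 * γ * q * m * (Q / t) ≤ m * Q / 2 := by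
    calc 2 * γ * q * m * (Q / t) = (16 * (γ * q)) / t * (m * Q / 8) := by ring
      _ ≤ 1 * (m * Q / 8) := by gcongr; rwa [div_le_one ht0]
      _ ≤ _ := by nlinarith [mul_pos hm hQ0]
  have e3 : 0 ≤ 2 * γ * q * m * (Q / t) := by positivity
  have e4 := abs_le.1 e1
  constructor <;> linarith [e4.1, e4.2]

theorem coeff_b_deriv_bound {c α q t Q S P m m₁ m₂ k₁ k₂ : ℝ} (hα : 0 < α - 1) (hc : 0 < c)
    (ht : 1 ≤ t) (hQ : 1 ≤ Q) (hS : 1 ≤ S) (hP : 0 < P) (hPt : P ≤ t) (hm : 0 < m)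
    (hq0 : 0 < q) (hq1 : q < 1) (hk₁ : 0 < k₁) (hk₂ : 0 < k₂)
    (hmQ : m * Q ≤ k₁) (hm₁ : t * |m₁| ≤ k₂ * m) (hm₂ : t ^ 2 * |m₂| ≤ k₂ * m)
    (h : 64 * (k₁ * (3 * k₂ + 1)) / c ≤ t) :
    |-(α - 1) * (q * m₁ * (Q / t) + q * m * ((q - 1) * (Q / t ^ 2)) + (m₂ * Q + m₁ * (q * (Q / t))))|
      ≤ c * (α - 1) * (Q * S / P) / 64 := by
  have ht0 : 0 < t := by linarith
  have hQ0 : 0 < Q := by linarith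
  have e1 := mul_abs_rpow_bound ht0 hQ0 hk₂ hmQ hm₁
  have e2 := mul_abs_rpow_bound (pow_pos ht0 2) hQ0 hk₂ hmQ hm₂
  have f1 : |q * m₁ * (Q / t)| ≤ k₁ * k₂ / t ^ 2 := by
    calc |q * m₁ * (Q / t)| = q * |m₁ * Q| / t := by
          rw [show q * m₁ * (Q / t) = q * (m₁ * Q) / t by ring, abs_div, abs_mul,
            abs_of_pos hq0, abs_of_pos ht0]
      _ ≤ 1 * (k₁ * k₂ / t) / t := by gcongr
      _ = _ := by field_simp
  have f2 : |q * m * ((q - 1) * (Q / t ^ 2))| ≤ k₁ / t ^ 2 := by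
    calc |q * m * ((q - 1) * (Q / t ^ 2))| = q * (1 - q) * (m * Q) / t ^ 2 := by
          rw [show q * m * ((q - 1) * (Q / t ^ 2)) = -(q * (1 - q) * (m * Q) / t ^ 2) by ring,
            abs_neg, abs_of_nonneg]
          have : 0 ≤ 1 - q := by linarith
          positivity
      _ ≤ 1 * k₁ / t ^ 2 := by
          gcongr
          nlinarith
      _ = _ := by ring
  have f3 : |m₁ * (q * (Q / t))| ≤ k₁ * k₂ / t ^ 2 := by
    rwa [show m₁ * (q * (Q / t)) = q * m₁ * (Q / t) by ring]
  have hsum : |q * m₁ * (Q / t) + q * m * ((q - 1) * (Q / t ^ 2)) + (m₂ * Q + m₁ * (q * (Q / t)))|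
      ≤ k₁ * (3 * k₂ + 1) / t ^ 2 := by
    refine (abs_add_le _ _).trans ?_
    have g1 := abs_add_le (q * m₁ * (Q / t)) (q * m * ((q - 1) * (Q / t ^ 2)))
    have g2 := abs_add_le (m₂ * Q) (m₁ * (q * (Q / t)))
    have : k₁ * (3 * k₂ + 1) / t ^ 2 = k₁ * k₂ / t ^ 2 + k₁ / t ^ 2 + (k₁ * k₂ / t ^ 2 +
      k₁ * k₂ / t ^ 2) := by ring
    linarith
  have hu : 1 / t ≤ Q * S / P := by
    rw [div_le_div_iff₀ ht0 hP]
    nlinarith [one_le_mul_of_one_le_of_one_le hQ hS]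
  have hfin : k₁ * (3 * k₂ + 1) / t ^ 2 ≤ c * (1 / t) / 64 := by
    rw [div_le_iff₀ hc] at h
    rw [div_le_iff₀ (by positivity)]
    have : c * (1 / t) / 64 * t ^ 2 = c * t / 64 := by field_simp
    linarith
  rw [abs_mul, abs_neg, abs_of_pos hα]
  calc _ ≤ (α - 1) * (k₁ * (3 * k₂ + 1) / t ^ 2) := by gcongr
    _ ≤ (α - 1) * (c * (1 / t) / 64) := by gcongr
    _ ≤ (α - 1) * (c * (Q * S / P) / 64) := by gcongr
    _ = _ := by ring

theorem coeff_gap_deriv_bound {α γ q s t Q S m m₁ m₂ a k₁ k₂ : ℝ} (hα : 0 < α - 1)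
    (ht : 1 ≤ t) (hQ : 1 ≤ Q) (hS : 1 ≤ S) (hm : 0 < m) (hγ : 0 < γ) (hs : 0 < s)
    (hq0 : 0 < q) (hq1 : q < 1) (hk₁ : 0 < k₁) (hk₂ : 0 < k₂)
    (hmQ : m * Q ≤ k₁) (hm₁ : t * |m₁| ≤ k₂ * m) (hm₂ : t ^ 2 * |m₂| ≤ k₂ * m)
    (ha : a ≤ 3 * m * (Q * S))
    (h : 4 * (k₁ * (k₂ + (q + s) + 4 * γ * k₂ + 2 * γ + 3)) / (α - 1) ≤ t) :
    (m₁ * (Q * S) + m * ((q + s) * (Q * S / t)) -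
        (2 * γ * q * m₁ * (Q / t) + 2 * γ * q * m * ((q - 1) * (Q / t ^ 2))) -
        (γ * m₂ * Q + γ * m₁ * (q * (Q / t)))) * Q + a * (q * (Q / t)) ≤
      (α - 1) / 4 * (Q * S) := by
  have ht0 : 0 < t := by linarith
  have hQ0 : 0 < Q := by linarith
  have hS0 : 0 < S := by linarith
  have e1 := abs_le.1 (mul_abs_rpow_bound ht0 hQ0 hk₂ hmQ hm₁)
  have e2 := abs_le.1 (mul_abs_rpow_bound (pow_pos ht0 2) hQ0 hk₂ hmQ hm₂)
  have hQt : Q / t ≤ Q * S / t := by gcongr; nlinarith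
  have hQt2 : Q / t ^ 2 ≤ Q * S / t := by
    refine le_trans ?_ hQt
    gcongr; nlinarith
  have g1 : m₁ * Q * (Q * S) ≤ k₁ * k₂ / t * (Q * S) := by gcongr; exact e1.2
  have g2 : (q + s) * (m * Q) * (Q * S / t) ≤ (q + s) * k₁ * (Q * S / t) := by gcongr
  have hqt : k₁ * k₂ / t ≤ k₁ * k₂ := div_le_self (by positivity) ht
  have g3 : 3 * γ * q * (-(m₁ * Q)) * (Q / t) ≤ 3 * γ * 1 * (k₁ * k₂) * (Q * S / t) := by
    calc 3 * γ * q * (-(m₁ * Q)) * (Q / t) ≤ 3 * γ * q * (k₁ * k₂) * (Q / t) := by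
          gcongr; linarith [e1.1]
      _ ≤ _ := by gcongr
  have g4 : 2 * γ * (q * (1 - q)) * (m * Q) * (Q / t ^ 2) ≤ 2 * γ * 1 * k₁ * (Q * S / t) := by
    gcongr; nlinarith
  have g5 : γ * (-(m₂ * Q)) * Q ≤ γ * (k₁ * k₂) * (Q * S / t) := by
    calc γ * (-(m₂ * Q)) * Q ≤ γ * (k₁ * k₂ / t ^ 2) * Q := by gcongr; linarith [e2.1]
      _ = γ * (k₁ * k₂) * (Q / t ^ 2) := by ring
      _ ≤ _ := by gcongr
  have g6 : a * (q * (Q / t)) ≤ 3 * k₁ * (Q * S / t) := by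
    calc a * (q * (Q / t)) ≤ 3 * m * (Q * S) * (1 * (Q / t)) := by gcongr
      _ = 3 * (m * Q) * (Q * S / t) := by ring
      _ ≤ _ := by gcongr
  have hfin : k₁ * (k₂ + (q + s) + 4 * γ * k₂ + 2 * γ + 3) * (Q * S / t) ≤
      (α - 1) / 4 * (Q * S) := by
    rw [div_le_iff₀ hα] at h
    calc _ ≤ (t * (α - 1) / 4) * (Q * S / t) := by gcongr; linarith
      _ = _ := by field_simp
  have hring : (m₁ * (Q * S) + m * ((q + s) * (Q * S / t)) -
        (2 * γ * q * m₁ * (Q / t) + 2 * γ * q * m * ((q - 1) * (Q / t ^ 2))) -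
        (γ * m₂ * Q + γ * m₁ * (q * (Q / t)))) * Q + a * (q * (Q / t)) =
      m₁ * Q * (Q * S) + (q + s) * (m * Q) * (Q * S / t) + 2 * γ * q * (-(m₁ * Q)) * (Q / t)
        + 2 * γ * (q * (1 - q)) * (m * Q) * (Q / t ^ 2) + γ * (-(m₂ * Q)) * Q +
        γ * q * (-(m₁ * Q)) * (Q / t) + a * (q * (Q / t)) := by ring
  have hsum : k₁ * (k₂ + (q + s) + 4 * γ * k₂ + 2 * γ + 3) * (Q * S / t) =
      k₁ * k₂ / t * (Q * S) + (q + s) * k₁ * (Q * S / t) + 2 * γ * 1 * (k₁ * k₂) * (Q * S / t) +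
      2 * γ * 1 * k₁ * (Q * S / t) + γ * (k₁ * k₂) * (Q * S / t) +
      γ * 1 * (k₁ * k₂) * (Q * S / t) + 3 * k₁ * (Q * S / t) := by ring
  linarith

theorem rpow_weights_eq {t : ℝ} (ht : 0 < t) (p q s : ℝ) (S P Q : ℝ) (hS : S = t ^ s)
    (hP : P = t ^ p) (hQ : Q = t ^ q) :
    t ^ (q + s) = Q * S ∧ t ^ (q - 1) = Q / t ∧ t ^ (q - 1 - 1) = Q / t ^ 2 ∧
      t ^ (q + s - 1) = Q * S / t ∧ t ^ (2 * q + s) = Q ^ 2 * S ∧ t ^ (2 * q - 1) = Q ^ 2 / t ∧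
      t ^ (2 * q) = Q ^ 2 ∧ t ^ (3 * q + s + p - 2) = Q ^ 3 * S * P / t ^ 2 ∧
      t ^ (2 * q + s - p - 1) = Q ^ 2 * S / (P * t) := by
  have h2 : t ^ (2 * q) = Q ^ 2 := by rw [mul_comm, rpow_mul ht.le, hQ]; norm_cast
  have h3 : t ^ (3 * q) = Q ^ 3 := by rw [mul_comm, rpow_mul ht.le, hQ]; norm_cast
  have ht2 : t ^ (2 : ℝ) = t ^ 2 := by norm_cast
  simp only [rpow_sub ht, rpow_add ht, h2, h3, ht2, rpow_one, ← hS, ← hP, ← hQ, div_div, ← pow_two,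
    and_self]

theorem coeff_gap_hasDerivAt {m m' a : ℝ → ℝ} {γ q s t m₂ : ℝ} (ht : 0 < t)
    (hm : HasDerivAt m (m' t) t) (hm' : HasDerivAt m' m₂ t)
    (ha : ∀ t, a t = m t * t ^ (q+s) - 2 * γ * q * m t * t ^ (q-1) - γ * m' t * t ^ q + γ) :
    HasDerivAt (fun τ => a τ * τ ^ q)
      ((m' t * (t ^ q * t ^ s) + m t * ((q + s) * (t ^ q * t ^ s / t)) -
        (2 * γ * q * m' t * (t ^ q / t) + 2 * γ * q * m t * ((q - 1) * (t ^ q / t ^ 2))) -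
        (γ * m₂ * t ^ q + γ * m' t * (q * (t ^ q / t)))) * t ^ q + a t * (q * (t ^ q / t))) t := by
  obtain ⟨h1, h2, h3, h4, -⟩ := rpow_weights_eq ht 0 q s _ _ _ rfl rfl rfl
  have hpow : ∀ e, HasDerivAt (fun τ : ℝ => τ ^ e) (e * t ^ (e - 1)) t := fun e =>
    hasDerivAt_rpow_const (Or.inl ht.ne')
  have hd := ((((hm.mul (hpow (q + s))).sub ((hm.const_mul (2 * γ * q)).mul (hpow (q - 1)))).sub
    ((hm'.const_mul γ).mul (hpow q))).add_const γ)
  rw [h1, h2, h3, h4] at hd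
  have had : HasDerivAt a _ t := hd.congr_of_eventuallyEq (Eventually.of_forall ha)
  refine (had.mul (hpow q)).congr_deriv ?_
  rw [h2]

theorem coeff_b_hasDerivAt {m m' bb : ℝ → ℝ} {α q t m₂ : ℝ} (ht : 0 < t)
    (hm : HasDerivAt m (m' t) t) (hm' : HasDerivAt m' m₂ t)
    (hbb : ∀ t, bb t = -(α - 1) * (q * m t * t ^ (q-1) + m' t * t ^ q - 1)) :
    HasDerivAt bb (-(α - 1) * (q * m' t * (t ^ q / t) + q * m t * ((q - 1) * (t ^ q / t ^ 2)) +
      (m₂ * t ^ q + m' t * (q * (t ^ q / t))))) t := by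
  obtain ⟨-, h2, h3, -⟩ := rpow_weights_eq ht 0 q 0 _ _ _ rfl rfl rfl
  have hpow : ∀ e, HasDerivAt (fun τ : ℝ => τ ^ e) (e * t ^ (e - 1)) t := fun e =>
    hasDerivAt_rpow_const (Or.inl ht.ne')
  have hd := ((((hm.const_mul q).mul (hpow (q - 1))).add (hm'.mul (hpow q))).sub_const 1).const_mul
    (-(α - 1))
  rw [h2, h3] at hd
  exact hd.congr_of_eventuallyEq (Eventually.of_forall hbb)

theorem tikhonov_coeff_hasDerivAt {c p t : ℝ} (ht : 0 < t) :
    HasDerivAt (fun τ : ℝ => c / τ ^ p) (-(c * p / (t ^ p * t))) t := by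
  have h := ((hasDerivAt_rpow_const (x := t) (p := -p) (Or.inl ht.ne')).const_mul c)
  rw [rpow_sub ht, rpow_one, rpow_neg ht.le] at h
  refine (h.congr_of_eventuallyEq ?_).congr_deriv (by field_simp)
  filter_upwards [eventually_gt_nhds ht] with τ hτ
  rw [rpow_neg hτ.le, div_eq_mul_inv]

theorem velocity_hasDerivAt {X : Type*} [NormedAddCommGroup X] [InnerProductSpace ℝ X]
    {x xt x' G : ℝ → X} {m : ℝ → ℝ} {x'' xt' gder : X} {α γ q s t m₁ β w : ℝ} (ht : 0 < t)
    (hm : HasDerivAt m m₁ t) (hx : HasDerivAt x (x' t) t) (hx' : HasDerivAt x' x'' t)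
    (hxt : HasDerivAt xt xt' t) (hG : HasDerivAt G gder t)
    (hode : m t • x'' + (α / t ^ q) • x' t + γ • gder + t ^ s • G t = 0)
    (hβ : β = 1 - q * m t * (t ^ q / t) - m₁ * t ^ q)
    (hw : w = t ^ q * t ^ s - γ * q * (t ^ q / t)) :
    HasDerivAt (fun τ => (α - 1) • (x τ - xt τ) + τ ^ q • (m τ • x' τ + γ • G τ))
      (-(β • x' t) - (α - 1) • xt' - w • G t) t := by
  have hpow : HasDerivAt (fun τ : ℝ => τ ^ q) (q * (t ^ q / t)) t := by
    have := hasDerivAt_rpow_const (x := t) (p := q) (Or.inl ht.ne')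
    rwa [rpow_sub ht, rpow_one] at this
  have hd := ((hx.sub hxt).const_smul (α - 1)).add
    (hpow.smul ((hm.smul hx').add (hG.const_smul γ)))
  refine hd.congr_deriv ?_
  have hQ : t ^ q ≠ 0 := (rpow_pos_of_pos ht q).ne'
  have hacc : m t • x'' + γ • gder = -((α / t ^ q) • x' t) - t ^ s • G t := by
    rw [← sub_eq_zero, ← hode]; abel
  have hacc' : m t • x'' + m₁ • x' t + γ • gder =
      -((α / t ^ q) • x' t) - t ^ s • G t + m₁ • x' t := by rw [← hacc]; abel
  simp only [Pi.add_apply, Pi.smul_apply, Pi.smul_apply']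
  rw [hacc', hβ, hw]
  generalize t ^ q = Q at *
  simp only [smul_add, smul_sub, smul_neg, smul_smul, mul_div_cancel₀ _ hQ]
  module

theorem energy_hasDerivAt {X Y : Type*} [NormedAddCommGroup X] [InnerProductSpace ℝ X]
    [NormedAddCommGroup Y] [InnerProductSpace ℝ Y] {C gap bb : ℝ → ℝ} {v z : ℝ → X} {η : ℝ → Y}
    {t C' gap' b' : ℝ} {v' z' : X} {η' : Y} (hC : HasDerivAt C C' t)
    (hgap : HasDerivAt gap gap' t) (hbb : HasDerivAt bb b' t) (hv : HasDerivAt v v' t)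
    (hz : HasDerivAt z z' t) (hη : HasDerivAt η η' t) :
    HasDerivAt (fun τ => C τ * gap τ + (1/2) * ‖v τ‖ ^ 2 + (1/2) * bb τ * ‖z τ‖ ^ 2 +
        (1/2) * ‖η τ‖ ^ 2)
      (C' * gap t + C t * gap' + ⟪v t, v'⟫ + 1 / 2 * b' * ‖z t‖ ^ 2 + bb t * ⟪z t, z'⟫ +
        ⟪η t, η'⟫) t := by
  refine ((((hC.mul hgap).add (hv.norm_sq.const_mul (1/2))).add
    ((hbb.const_mul (1/2)).mul hz.norm_sq)).add (hη.norm_sq.const_mul (1/2))).congr_deriv ?_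
  ring

theorem regularized_saddle_path_bound
    {X Y : Type*} [NormedAddCommGroup X] [InnerProductSpace ℝ X] [CompleteSpace X]
    [NormedAddCommGroup Y] [InnerProductSpace ℝ Y] [CompleteSpace Y]
    {f : X → ℝ} {f' : X → X} (hf : ∀ u, HasGradientAt f (f' u) u)
    (hconv : ConvexOn ℝ Set.univ f) (A : X →L[ℝ] Y) (b : Y) {c p t₀ : ℝ} (hc : 0 < c)
    (hp0 : 0 < p) (hp1 : p < 1) (ht₀ : 0 < t₀) {xs : X} {ls : Y}
    (hs : ∀ y μ, f xs + ⟪μ, A xs - b⟫ ≤ f xs + ⟪ls, A xs - b⟫ ∧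
      f xs + ⟪ls, A xs - b⟫ ≤ f y + ⟪ls, A y - b⟫)
    {xt xt' : ℝ → X} {lt lt' : ℝ → Y}
    (hsaddle : ∀ t ≥ t₀, f' (xt t) + ContinuousLinearMap.adjoint A (lt t) + (c / t ^ p) • xt t = 0 ∧
      A (xt t) - b - (c / t ^ p) • lt t = 0)
    (hxt : ∀ t ≥ t₀, HasDerivAt xt (xt' t) t) (hlt : ∀ t ≥ t₀, HasDerivAt lt (lt' t) t) :
    ∃ K ≥ 0, ∀ t > t₀, ‖xt t‖ ≤ K ∧ ‖xt' t‖ ≤ K / t ∧ ‖lt' t‖ ≤ K / t := by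
  refine ⟨√(‖xs‖ ^ 2 + ‖ls‖ ^ 2), sqrt_nonneg _, fun t ht => ?_⟩
  have ht0 : 0 < t := ht₀.trans ht
  have hP : 0 < t ^ p := rpow_pos_of_pos ht0 p
  have hk : 0 < c / t ^ p := by positivity
  have hK : ‖xt t‖ ^ 2 + ‖lt t‖ ^ 2 ≤ √(‖xs‖ ^ 2 + ‖ls‖ ^ 2) ^ 2 := by
    rw [sq_sqrt (by positivity)]
    exact regularized_saddle_norm_bound hf hconv A b hk hs (hsaddle t ht.le).1 (hsaddle t ht.le).2
  have hder := regularized_saddle_deriv_bound hf hconv A b (hxt t ht.le) (hlt t ht.le)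
    (tikhonov_coeff_hasDerivAt (c := c) (p := p) ht0)
    ((eventually_gt_nhds ht).mono fun τ hτ => hsaddle τ hτ.le)
  have hder' : ‖xt' t‖ ^ 2 + ‖lt' t‖ ^ 2 ≤ p / t * (⟪xt' t, xt t⟫ + ⟪lt' t, lt t⟫) := by
    refine le_of_mul_le_mul_left (hder.trans (le_of_eq ?_)) hk
    field_simp
  obtain ⟨h1, h2⟩ := norm_bound_of_sq_le_inner (by positivity) (sqrt_nonneg _) hK hder'
  have hle : p / t * √(‖xs‖ ^ 2 + ‖ls‖ ^ 2) ≤ √(‖xs‖ ^ 2 + ‖ls‖ ^ 2) / t := by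
    rw [div_mul_eq_mul_div]
    gcongr
    exact mul_le_of_le_one_left (sqrt_nonneg _) hp1.le
  exact ⟨abs_le_of_sq_le_sq' (by nlinarith [sq_nonneg ‖lt t‖]) (sqrt_nonneg _) |>.2,
    h1.trans hle, h2.trans hle⟩

set_option maxHeartbeats 2000000 in
theorem energy_differential_inequality
    {X Y : Type*} [NormedAddCommGroup X] [InnerProductSpace ℝ X] [CompleteSpace X]
    [NormedAddCommGroup Y] [InnerProductSpace ℝ Y] [CompleteSpace Y]
    (f : X → ℝ) (f' : X → X) (hf : ∀ u, HasGradientAt f (f' u) u)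
    (hconv : ConvexOn ℝ Set.univ f)
    (A : X →L[ℝ] Y) (b : Y)
    (L : X → Y → ℝ) (hL : ∀ u lam, L u lam = f u + ⟪lam, A u - b⟫)
    (c p t₀ : ℝ) (hc : 0 < c) (hp0 : 0 < p) (hp1 : p < 1) (ht₀ : 0 < t₀)
    (Lt : ℝ → X → Y → ℝ)
    (hLt : ∀ t u lam, Lt t u lam = L u lam + (c / (2 * t ^ p)) * (‖u‖ ^ 2 - ‖lam‖ ^ 2))
    (gx : ℝ → X → Y → X)
    (hgx : ∀ t u lam, gx t u lam = f' u + ContinuousLinearMap.adjoint A lam + (c / t ^ p) • u)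
    (gl : ℝ → X → Y → Y)
    (hgl : ∀ t u lam, gl t u lam = A u - b - (c / t ^ p) • lam)
    (Om : Set (X × Y))
    (hOm : Om = {z : X × Y | ∀ u μ, L z.1 μ ≤ L z.1 z.2 ∧ L z.1 z.2 ≤ L u z.2})
    (hOmne : Om.Nonempty)
    (α q γ s : ℝ) (hα : 1 < α) (hq0 : 0 < q) (hq1 : q < 1) (hγ : 0 < γ) (hs : 0 < s)
    (m m' m'' : ℝ → ℝ)
    (hmpos : ∀ t ≥ t₀, 0 < m t)
    (hmmono : AntitoneOn m (Set.Ici t₀))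
    (hmd : ∀ t ≥ t₀, HasDerivAt m (m' t) t)
    (hmd2 : ∀ t ≥ t₀, HasDerivAt m' (m'' t) t)
    (θ : ℝ → ℝ)
    (hθ : ∀ t, θ t = (m t * t ^ (2*q+s) + γ * t ^ q - 2 * m t * γ * q * t ^ (2*q-1)
      - γ * m' t * t ^ (2*q)) / ((α - 1) * (t ^ (q+s) - γ * q * t ^ (q-1))))
    (k₁ k₂ T₁ T₂ : ℝ) (hk₁ : 0 < k₁) (hk₂ : 0 < k₂) (hT₁ : t₀ ≤ T₁) (hT₂ : t₀ ≤ T₂)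
    (hA1 : ∀ t ≥ T₁, γ / t ^ (q+s) ≤ m t ∧ m t ≤ k₁ / t ^ q)
    (hA2 : ∀ t ≥ T₂, t * |m' t| ≤ k₂ * m t ∧ t ^ 2 * |m'' t| ≤ k₂ * m t)
    (x : ℝ → X) (lam : ℝ → Y) (x' x'' : ℝ → X) (lam' : ℝ → Y) (gder : ℝ → X)
    (hx : ∀ t ≥ t₀, HasDerivAt x (x' t) t)
    (hx' : ∀ t ≥ t₀, HasDerivAt x' (x'' t) t)
    (hx''c : ContinuousOn x'' (Set.Ici t₀))
    (hlam : ∀ t ≥ t₀, HasDerivAt lam (lam' t) t)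
    (hlamc : ContinuousOn lam' (Set.Ici t₀))
    (hgder : ∀ t ≥ t₀, HasDerivAt (fun τ => gx τ (x τ) (lam τ)) (gder t) t)
    (hode1 : ∀ t ≥ t₀, m t • x'' t + (α / t ^ q) • x' t + γ • gder t
      + t ^ s • gx t (x t) (lam t) = 0)
    (hode2 : ∀ t ≥ t₀, lam' t = ((α - 1) * (t ^ (q+s) - γ * q * t ^ (q-1)))
      • gl t (x t + θ t • x' t) (lam t))
    (xt : ℝ → X) (lt : ℝ → Y)
    (hsaddle : ∀ t ≥ t₀, gx t (xt t) (lt t) = 0 ∧ gl t (xt t) (lt t) = 0)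
    (xt' : ℝ → X) (lt' : ℝ → Y)
    (hxt : ∀ t ≥ t₀, HasDerivAt xt (xt' t) t)
    (hlt : ∀ t ≥ t₀, HasDerivAt lt (lt' t) t)
    (hxtc : ContinuousOn xt' (Set.Ici t₀))
    (hltc : ContinuousOn lt' (Set.Ici t₀))
    (a bb : ℝ → ℝ)
    (haf : ∀ t, a t = m t * t ^ (q+s) - 2 * γ * q * m t * t ^ (q-1) - γ * m' t * t ^ q + γ)
    (hbf : ∀ t, bb t = -(α - 1) * (q * m t * t ^ (q-1) + m' t * t ^ q - 1))
    (E : ℝ → ℝ)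
    (hE : ∀ t, E t = a t * t ^ q * (Lt t (x t) (lt t) - Lt t (xt t) (lt t))
      + (1/2) * ‖(α - 1) • (x t - xt t) + t ^ q • (m t • x' t + γ • gx t (x t) (lam t))‖ ^ 2
      + (1/2) * bb t * ‖x t - xt t‖ ^ 2 + (1/2) * ‖lam t - lt t‖ ^ 2)
    (r a₁ M : ℝ) (hr : r = max q (p - q - s))
    (ha₁ : 1 / (c * (α - 1)) < a₁)
    (hM0 : 0 < M) (hM : M < min (3 * c / (4 * (2 * α - 1))) (c * (α - 1) - 1 / a₁)) :
    ∃ C₀ ≥ (0:ℝ), ∃ T ≥ t₀, ∀ t ≥ T, ∀ d : ℝ, HasDerivAt E d t →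
      d + (M / t ^ r) * E t ≤ C₀ * (m t * t ^ (3*q+s+p-2) + m t * t ^ (2*q+s-p-1)) := by
  subst hr
  have hα' : 0 < α - 1 := by linarith
  have ha₁0 : 0 < a₁ := lt_trans (by positivity) ha₁
  obtain ⟨hM1, hM2⟩ := lt_min_iff.1 hM
  have hM' : M * (4 * (2 * α - 1)) ≤ 3 * c :=
    ((lt_div_iff₀ (by linarith)).1 hM1).le
  have hM'' : M ≤ c * (α - 1) := by
    have : 0 < 1 / a₁ := by positivity
    linarith
  obtain ⟨⟨xs, ls⟩, hz⟩ := hOmne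
  simp only [hOm, Set.mem_ofPred_eq, hL] at hz
  simp only [hgx, hgl] at hsaddle
  obtain ⟨K, hK, hpath⟩ := regularized_saddle_path_bound hf hconv A b hc hp0 hp1 ht₀
    hz hsaddle hxt hlt
  obtain ⟨C₀, hC₀, hest⟩ := energy_scalar_estimate hc hp0 hα hγ hk₁ hM0 hM' hM'' hK
    (norm_nonneg A)
  have hQlim := (tendsto_rpow_atTop hq0).eventually_ge_atTop
  have hev : ∀ᶠ t in atTop, t₀ < t ∧ T₁ ≤ t ∧ T₂ ≤ t ∧ 1 ≤ t ∧ 16 * (γ * q) ≤ t ∧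
      2 * (γ * k₂) ≤ t ∧ 32 * k₁ ≤ t ∧ 32 * (k₁ * k₂) ≤ t ∧
      64 * (k₁ * (3 * k₂ + 1)) / c ≤ t ∧
      4 * (k₁ * (k₂ + (q + s) + 4 * γ * k₂ + 2 * γ + 3)) / (α - 1) ≤ t ∧
      8 * M * k₁ ≤ t ^ q ∧ 6 * M * k₁ / (α - 1) ≤ t ^ q ∧ 4 * M * γ ≤ t ^ q := by
    simp only [eventually_and]
    exact ⟨eventually_gt_atTop _, eventually_ge_atTop _, eventually_ge_atTop _,
      eventually_ge_atTop _, eventually_ge_atTop _, eventually_ge_atTop _, eventually_ge_atTop _,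
      eventually_ge_atTop _, eventually_ge_atTop _, eventually_ge_atTop _, hQlim _, hQlim _,
      hQlim _⟩
  obtain ⟨T, hT⟩ := eventually_atTop.1 hev
  refine ⟨C₀, hC₀, max T t₀, le_max_right _ _, fun t ht d hd => ?_⟩
  obtain ⟨ht1, hA1t, hA2t, ht1', w1, a2, β1, β2, b1, g1, q1, q2, q3⟩ := hT t (le_of_max_le_left ht)
  have htt₀ : t₀ ≤ t := ht1.le
  have ht0 : 0 < t := ht₀.trans ht1
  obtain ⟨hKx, hKx', hKl'⟩ := hpath t ht1
  obtain ⟨hm1, hm2⟩ := hA2 t hA2t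
  obtain ⟨hmlow, hmup⟩ := hA1 t hA1t
  have hm := hmpos t htt₀
  obtain ⟨hsx, hsl⟩ := hsaddle t htt₀
  -- the derivative of the energy
  obtain ⟨k, hk⟩ : ∃ k : ℝ → ℝ, k = fun τ => c / τ ^ p := ⟨_, rfl⟩
  have hkt : c / t ^ p = k t := by rw [hk]
  obtain ⟨gap, hgapdef⟩ : ∃ gap : ℝ → ℝ, gap = fun τ =>
    (f (x τ) + ⟪lt τ, A (x τ) - b⟫ + k τ / 2 * (‖x τ‖ ^ 2 - ‖lt τ‖ ^ 2)) -
      (f (xt τ) + ⟪lt τ, A (xt τ) - b⟫ + k τ / 2 * (‖xt τ‖ ^ 2 - ‖lt τ‖ ^ 2)) := ⟨_, rfl⟩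
  obtain ⟨G, hG⟩ : ∃ G : ℝ → X, G = fun τ => gx τ (x τ) (lam τ) := ⟨_, rfl⟩
  have hEeq : E = fun τ => (a τ * τ ^ q) * gap τ +
      (1/2) * ‖(α - 1) • (x τ - xt τ) + τ ^ q • (m τ • x' τ + γ • G τ)‖ ^ 2 +
      (1/2) * bb τ * ‖x τ - xt τ‖ ^ 2 + (1/2) * ‖lam τ - lt τ‖ ^ 2 := by
    funext τ
    have hhalf : c / (2 * τ ^ p) = c / τ ^ p / 2 := by rw [div_div, mul_comm]
    rw [hE, hgapdef, hk, hG, hLt, hLt, hL, hL, hhalf]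
  have hgapd : HasDerivAt gap (⟪f' (x t) + ContinuousLinearMap.adjoint A (lt t) + k t • x t, x' t⟫ +
      ⟪lt' t, A (x t - xt t)⟫ +
      -(c * p / (t ^ p * t)) / 2 * (‖x t‖ ^ 2 - ‖xt t‖ ^ 2)) t := by
    rw [hgapdef]
    exact lagrangian_gap_hasDerivAt hf A b (hx t htt₀) (hxt t htt₀) (hlt t htt₀)
      (hk ▸ tikhonov_coeff_hasDerivAt ht0) (hkt ▸ hsx)
  have hdE := energy_hasDerivAt (coeff_gap_hasDerivAt ht0 (hmd t htt₀) (hmd2 t htt₀) haf) hgapd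
    (coeff_b_hasDerivAt ht0 (hmd t htt₀) (hmd2 t htt₀) hbf)
    (velocity_hasDerivAt ht0 (hmd t htt₀) (hx t htt₀) (hx' t htt₀) (hxt t htt₀)
      (hG ▸ hgder t htt₀) (by rw [hG]; exact hode1 t htt₀) rfl rfl)
    ((hx t htt₀).sub (hxt t htt₀)) ((hlam t htt₀).sub (hlt t htt₀))
  simp only [Pi.sub_apply] at hdE
  rw [← hEeq] at hdE
  rw [hd.unique hdE]
  have hEt := congrFun hEeq t
  clear hdE hEeq hd
  -- passing to the weights `t ^ q`, `t ^ s`, `t ^ p`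
  have hQ1 : 1 ≤ t ^ q := one_le_rpow ht1' hq0.le
  have hS1 : 1 ≤ t ^ s := one_le_rpow ht1' hs.le
  have hP1 : 1 ≤ t ^ p := one_le_rpow ht1' hp0.le
  have hPt : t ^ p ≤ t := by simpa using rpow_le_rpow_of_exponent_le ht1' hp1.le
  have hR0 : 0 < (t ^ max q (p - q - s))⁻¹ := inv_pos.2 (rpow_pos_of_pos ht0 _)
  have hRQ : (t ^ max q (p - q - s))⁻¹ ≤ (t ^ q)⁻¹ := by
    gcongr
    exact le_max_left _ _
  have hRu : (t ^ max q (p - q - s))⁻¹ ≤ t ^ q * t ^ s / t ^ p := by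
    rw [← rpow_neg ht0.le, ← rpow_add ht0, ← rpow_sub ht0]
    exact rpow_le_rpow_of_exponent_le ht1' (by linarith [le_max_right q (p - q - s)])
  obtain ⟨e1, e2, -, -, e5, e6, e7, e8, e9⟩ := rpow_weights_eq ht0 p q s _ _ _ rfl rfl rfl
  have hat := haf t
  have hbt := hbf t
  have hθt := hθ t
  have hlamt := hode2 t htt₀
  rw [div_eq_mul_inv M, e8, e9]
  rw [e1] at hmlow
  rw [e1, e2] at hat hlamt
  rw [e2] at hbt
  rw [e5, e6, e7, e1, e2] at hθt
  rw [hkt] at hsx hsl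
  have hgt : G t = f' (x t) + ContinuousLinearMap.adjoint A (lt t) + k t • x t +
      ContinuousLinearMap.adjoint A (lam t - lt t) := by
    simp only [hG, hgx, hkt, map_sub]; abel
  rw [hgl, hkt] at hlamt
  obtain ⟨hψ0, hψ⟩ := lagrangian_gap_bounds hf hconv A b (x t) (μ := lt t)
    (ψ := gap t) (by rw [hk]; positivity) hsx (by rw [hgapdef])
  have hkP : k t = c / t ^ p := hkt.symm
  clear hT hev hQlim hpath
  have hγm : γ ≤ m t * (t ^ q * t ^ s) := by
    rwa [div_le_iff₀ (by positivity)] at hmlow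
  have hmQ : m t * t ^ q ≤ k₁ := by
    rwa [le_div_iff₀ (by positivity)] at hmup
  have hwge := coeff_w_ge ht1' hQ1 hS1 w1
  obtain ⟨hβ1, hβ2⟩ := coeff_beta_bounds ht1' hQ1 hm hq0 hq1 hk₁ hk₂ hmQ hm1 β1 β2
  obtain ⟨ha0, ha3⟩ := coeff_a_bounds ht1' hQ1 hS1 hm hγ hq0 hm1 hγm w1 a2
  rw [← hat] at ha0 ha3
  have hb' := coeff_b_deriv_bound hα' hc ht1' hQ1 hS1 (by linarith) hPt hm hq0 hq1 hk₁ hk₂ hmQ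
    hm1 hm2 b1
  have hS' := coeff_gap_deriv_bound hα' ht1' hQ1 hS1 hm hγ hs hq0 hq1 hk₁ hk₂ hmQ hm1 hm2 ha3 g1
  generalize (m' t * (t ^ q * t ^ s) + m t * ((q + s) * (t ^ q * t ^ s / t)) -
        (2 * γ * q * m' t * (t ^ q / t) + 2 * γ * q * m t * ((q - 1) * (t ^ q / t ^ 2))) -
        (γ * m'' t * t ^ q + γ * m' t * (q * (t ^ q / t)))) * t ^ q +
        a t * (q * (t ^ q / t)) = S' at *
  generalize -(α - 1) * (q * m' t * (t ^ q / t) + q * m t * ((q - 1) * (t ^ q / t ^ 2)) +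
      (m'' t * t ^ q + m' t * (q * (t ^ q / t)))) = b' at *
  obtain ⟨w, hw⟩ : ∃ w, w = t ^ q * t ^ s - γ * q * (t ^ q / t) := ⟨_, rfl⟩
  obtain ⟨β, hβ⟩ : ∃ β, β = 1 - q * m t * (t ^ q / t) - m' t * t ^ q := ⟨_, rfl⟩
  have haβ : a t = w * m t + γ * β := by rw [hat, hw, hβ]; ring
  have hbβ : bb t = (α - 1) * β := by rw [hbt, hβ]; ring
  have hθa : θ t * ((α - 1) * w) = a t * t ^ q := by
    have : (α - 1) * w ≠ 0 := (mul_pos hα' (hw ▸ lt_of_lt_of_le (by positivity) hwge)).ne'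
    rw [hθt, ← hw, div_mul_cancel₀ _ this, hat]; ring
  rw [← hw] at hwge hlamt ⊢
  rw [← hβ] at hβ1 hβ2 ⊢
  clear hat hbt hθt hw hβ e1 e2 e5 e6 e7 e8 e9 hmlow hmup hm1 hm2 w1 a2 β1 β2 b1 g1
  have hlam' : lam' t - lt' t = ((α - 1) * w) • (A (x t - xt t) - k t • (lam t - lt t)) +
      (a t * t ^ q) • A (x' t) - lt' t := by
    have hb : b = A (xt t) - k t • lt t := by
      rw [sub_right_comm] at hsl
      exact (sub_eq_zero.1 hsl).symm
    rw [hlamt, ← hθa, hb, map_add, map_sub, map_smul]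
    module
  rw [hlam', hbβ, hEt, hbβ]
  generalize (t ^ max q (p - q - s))⁻¹ = R at *
  generalize t ^ q = Q at *
  generalize t ^ s = S at *
  generalize t ^ p = P at *
  have hQ0 : 0 < Q := by linarith
  have hP0 : 0 < P := by linarith
  have hmk : m t ≤ k₁ := (le_mul_of_one_le_right hm.le hQ1).trans hmQ
  have hQS : Q ≤ Q * S := le_mul_of_one_le_right hQ0.le hS1
  have hMa : M * R * a t * Q ≤ (α - 1) / 2 * (Q * S) := by
    have hRQ1 : R * Q ≤ 1 := by
      calc R * Q ≤ Q⁻¹ * Q := by gcongr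
        _ = 1 := inv_mul_cancel₀ hQ0.ne'
    have hMm : 6 * M * m t ≤ α - 1 := by
      rw [div_le_iff₀ hα'] at q2
      refine le_of_mul_le_mul_right ?_ hQ0
      calc 6 * M * m t * Q = 6 * M * (m t * Q) := by ring
        _ ≤ 6 * M * k₁ := by gcongr
        _ ≤ _ := by linarith
    calc M * R * a t * Q = M * a t * (R * Q) := by ring
      _ ≤ M * a t * 1 := by gcongr
      _ ≤ M * (3 * m t * (Q * S)) * 1 := by gcongr
      _ = 6 * M * m t / 2 * (Q * S) := by ring
      _ ≤ _ := by gcongr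
  have hMm : 8 * M * m t ≤ 1 := by
    refine le_of_mul_le_mul_right ?_ hQ0
    calc 8 * M * m t * Q = 8 * M * (m t * Q) := by ring
      _ ≤ 8 * M * k₁ := by gcongr
      _ ≤ 1 * Q := by linarith
  have hfin := hest t Q S P R (m t) w (a t) β S' b' (gap t) ‖x t - xt t‖ ‖x' t‖ ‖G t‖
    ‖lam t - lt t‖ ht1' hQ1 hS1 hP1 hm hR0 hRQ hRu hγm hmk hMm (q3.trans hQS) hwge ha3 hS' hMa
    hβ1 hβ2 hb' hψ0 (norm_nonneg _)
  have hder := energy_derivative_le A (x' := x' t) (Q := Q) hgt haβ hα'.le (by linarith)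
    ((by positivity : 0 ≤ 15 / 16 * (Q * S)).trans hwge) ha0 hQ0.le hm.le hγ.le hKx' hKl' hψ
  have hsq := mul_le_mul_of_nonneg_left
    (half_norm_sq_velocity_le (x t - xt t) (x' t) (G t) α Q (m t) γ) (mul_pos hM0 hR0).le
  have hreg : a t * Q * (-(c * p / (P * t)) / 2 * (‖x t‖ ^ 2 - ‖xt t‖ ^ 2)) ≤
      a t * Q * (c * p / (P * t) / 2 * K ^ 2) := by
    have h1 : ‖xt t‖ ^ 2 ≤ K ^ 2 := by gcongr
    have h2 : 0 ≤ c * p / (P * t) / 2 := by positivity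
    refine mul_le_mul_of_nonneg_left ?_ (mul_nonneg ha0 hQ0.le)
    nlinarith [sq_nonneg ‖x t‖]
  rw [hkP] at hder ⊢
  linarith
end

section
/- Suppose Assumptions A1 and A2 hold, 0 < p < 1 − q, 4q + s + p − 2 < 0, and 3q + s − p − 1 < 0. Let (x,λ) be a global solution of the dynamical system, let (x_t,λ_t) be the unique saddle point of L_t with t ↦ (x_t,λ_t) continuously differentiable, and let (x*,λ*) be the projection of the origin onto Ω. Then (x(t),λ(t)) converges strongly to (x*,λ*), i.e. lim_{t→+∞} ‖(x(t),λ(t)) − (x*,λ*)‖ = 0. -/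
open Real Filter Asymptotics
open scoped RealInnerProductSpace Topology

/-- First-order characterisation of convexity on a Hilbert space. -/
theorem ConvexOn.add_inner_gradient_le {X : Type*} [NormedAddCommGroup X]
    [InnerProductSpace ℝ X] [CompleteSpace X] {f : X → ℝ} {g u : X}
    (hconv : ConvexOn ℝ Set.univ f) (hf : HasGradientAt f g u) (v : X) :
    f u + ⟪g, v - u⟫ ≤ f v := by
  have hline : ConvexOn ℝ Set.univ (fun τ : ℝ => f (AffineMap.lineMap u v τ)) :=
    hconv.comp_affineMap (AffineMap.lineMap u v)
  have hd : HasDerivAt (fun τ : ℝ => f (AffineMap.lineMap u v τ)) ⟪g, v - u⟫ 0 := by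
    have h1 : HasDerivAt (fun τ : ℝ => AffineMap.lineMap u v τ) (v - u) (0 : ℝ) :=
      AffineMap.hasDerivAt_lineMap
    have h2 : HasFDerivAt f ((InnerProductSpace.toDual ℝ X) g)
        (AffineMap.lineMap u v (0 : ℝ)) := by
      simpa using hf.hasFDerivAt
    have h3 := h2.comp_hasDerivAt (0 : ℝ) h1
    rw [InnerProductSpace.toDual_apply_apply] at h3
    exact h3
  have h := hline.le_slope_of_hasDerivAt (Set.mem_univ 0) (Set.mem_univ 1) one_pos hd
  simp only [slope_def_field, AffineMap.lineMap_apply_one, AffineMap.lineMap_apply_zero] at h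
  linarith

/-- The difference of two points of a Tikhonov path, weighted by one regularization parameter,
is controlled by the difference of the parameters. -/
theorem tikhonov_inner_bound {H : Type*} [NormedAddCommGroup H] [InnerProductSpace ℝ H]
    {a b : ℝ} {y z : H} (h : ⟪a • y - b • z, y - z⟫ ≤ 0) :
    b * ‖z - y‖ ^ 2 ≤ (a - b) * ⟪y, z - y⟫ := by
  rw [norm_sub_sq_real]
  simp only [inner_sub_left, inner_sub_right, real_inner_smul_left, real_inner_self_eq_norm_sq]
    at h ⊢
  rw [real_inner_comm y z] at *
  linarith

theorem tikhonov_norm_sub_le {H : Type*} [NormedAddCommGroup H] [InnerProductSpace ℝ H]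
    {a b : ℝ} {y z : H} (h : ⟪a • y - b • z, y - z⟫ ≤ 0) :
    b * ‖z - y‖ ≤ |a - b| * ‖y‖ := by
  have h1 := tikhonov_inner_bound h
  rcases (norm_nonneg (z - y)).eq_or_lt with h0 | h0
  · rw [← h0]; simp; positivity
  · have h2 : (a - b) * ⟪y, z - y⟫ ≤ |a - b| * (‖y‖ * ‖z - y‖) := by
      refine (le_abs_self _).trans ?_
      rw [abs_mul]
      exact mul_le_mul_of_nonneg_left (abs_real_inner_le_norm _ _) (abs_nonneg _)
    refine le_of_mul_le_mul_right ?_ h0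
    nlinarith

/-- A bounded Tikhonov path converges strongly. -/
theorem tikhonov_path_tendsto {H : Type*} [NormedAddCommGroup H] [InnerProductSpace ℝ H]
    [CompleteSpace H] {z : ℝ → H} {e : ℝ → ℝ} {t₀ R : ℝ}
    (hpos : ∀ t ≥ t₀, 0 < e t) (hanti : StrictAntiOn e (Set.Ici t₀))
    (hmono : ∀ t₁ ≥ t₀, ∀ t₂ ≥ t₀, ⟪e t₁ • z t₁ - e t₂ • z t₂, z t₁ - z t₂⟫ ≤ 0)
    (hbdd : ∀ t ≥ t₀, ‖z t‖ ≤ R) : ∃ w, Tendsto z atTop (𝓝 w) := by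
  have key : ∀ t₁ ≥ t₀, ∀ t₂ ≥ t₁, ‖z t₂ - z t₁‖ ^ 2 ≤ ‖z t₂‖ ^ 2 - ‖z t₁‖ ^ 2 := by
    intro t₁ h1 t₂ h2
    rcases h2.eq_or_lt with rfl | h2
    · simp
    have h := tikhonov_inner_bound (hmono t₁ h1 t₂ (h1.trans h2.le))
    have he : 0 < e t₁ - e t₂ := sub_pos.2 (hanti h1 (h1.trans h2.le) h2)
    have hi : 0 ≤ ⟪z t₁, z t₂ - z t₁⟫ := by
      refine nonneg_of_mul_nonneg_right (le_trans ?_ h) he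
      have := hpos t₂ (h1.trans h2.le)
      positivity
    rw [inner_sub_right, real_inner_self_eq_norm_sq] at hi
    rw [norm_sub_sq_real, real_inner_comm]
    linarith
  set S := (fun t => ‖z t‖ ^ 2) '' Set.Ici t₀
  have hS : BddAbove S := by
    refine ⟨R ^ 2, ?_⟩
    rintro _ ⟨t, ht, rfl⟩
    exact pow_le_pow_left₀ (norm_nonneg _) (hbdd t ht) 2
  have hne : S.Nonempty := ⟨_, t₀, Set.self_mem_Ici, rfl⟩
  refine cauchySeq_tendsto_of_complete (Metric.cauchySeq_iff'.2 fun ε hε => ?_)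
  obtain ⟨_, ⟨T, hT, rfl⟩, hlt⟩ := exists_lt_of_lt_csSup hne
    (sub_lt_self (sSup S) (pow_pos hε 2))
  refine ⟨T, fun t ht => ?_⟩
  have h1 := key T hT t ht
  have h2 : ‖z t‖ ^ 2 ≤ sSup S := le_csSup hS ⟨t, le_trans hT ht, rfl⟩
  rw [dist_eq_norm]
  refine lt_of_pow_lt_pow_left₀ 2 hε.le ?_
  simp only at hlt
  linarith

/-- A differential inequality with decay rate `K / t ^ r`, `r < 1`, and vanishing relative
perturbation forces nonnegative functions to zero. -/
theorem tendsto_zero_of_deriv_le {E E' η : ℝ → ℝ} {K r T : ℝ} (hK : 0 < K) (hr : r < 1)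
    (hT : 0 < T) (hE : ∀ t ≥ T, HasDerivAt E (E' t) t) (hE0 : ∀ t ≥ T, 0 ≤ E t)
    (hle : ∀ t ≥ T, E' t ≤ K * t ^ (-r) * (η t - E t)) (hη : Tendsto η atTop (𝓝 0)) :
    Tendsto E atTop (𝓝 0) := by
  have hup : ∀ δ > 0, ∀ᶠ t in atTop, E t < 2 * δ := by
    intro δ hδ
    obtain ⟨T₁, hT₁⟩ := eventually_atTop.1
      ((hη.eventually_lt_const hδ).and (eventually_ge_atTop T))
    set T₂ := max T T₁
    set w : ℝ → ℝ := fun t => K / (1 - r) * t ^ (1 - r)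
    have hr' : 0 < 1 - r := by linarith
    have hw : ∀ t ≥ T, HasDerivAt w (K * t ^ (-r)) t := by
      intro t ht
      have h := (Real.hasDerivAt_rpow_const (x := t) (p := 1 - r)
        (Or.inl (hT.trans_le ht).ne')).const_mul (K / (1 - r))
      refine h.congr_deriv ?_
      rw [show 1 - r - 1 = -r by ring]
      field_simp
    have hF : ∀ t ≥ T, HasDerivAt (fun t => (E t - δ) * exp (w t))
        ((E' t + K * t ^ (-r) * (E t - δ)) * exp (w t)) t := by
      intro t ht
      refine (((hE t ht).sub_const δ).mul (hw t ht).exp).congr_deriv ?_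
      ring
    have hanti : AntitoneOn (fun t => (E t - δ) * exp (w t)) (Set.Ici T₂) := by
      refine antitoneOn_of_deriv_nonpos (convex_Ici _) ?_ ?_ ?_
      · exact fun t ht => (hF t (le_trans (le_max_left _ _) ht)).continuousAt.continuousWithinAt
      · rw [interior_Ici]
        exact fun t ht => (hF t (le_trans (le_max_left _ _)
          (le_of_lt ht))).differentiableAt.differentiableWithinAt
      · rw [interior_Ici]
        intro t ht
        have ht1 : T ≤ t := le_trans (le_max_left _ _) (le_of_lt ht)
        have ht2 : T₁ ≤ t := le_trans (le_max_right _ _) (le_of_lt ht)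
        rw [(hF t ht1).deriv]
        refine mul_nonpos_of_nonpos_of_nonneg ?_ (exp_pos _).le
        have h1 := hle t ht1
        have h2 : 0 < K * t ^ (-r) := mul_pos hK (rpow_pos_of_pos (hT.trans_le ht1) _)
        nlinarith [(hT₁ t ht2).1]
    have hwlim : Tendsto (fun t => (E T₂ - δ) * exp (w T₂) * exp (-w t)) atTop (𝓝 0) := by
      have h1 : Tendsto w atTop atTop :=
        (tendsto_rpow_atTop hr').const_mul_atTop (by positivity)
      simpa using (tendsto_exp_neg_atTop_nhds_zero.comp h1).const_mul
        ((E T₂ - δ) * exp (w T₂))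
    filter_upwards [hwlim.eventually_lt_const hδ, eventually_ge_atTop T₂] with t h1 h2
    have h3 := hanti Set.self_mem_Ici h2 h2
    have h4 : E t - δ ≤ (E T₂ - δ) * exp (w T₂) * exp (-w t) := by
      rw [exp_neg, ← div_eq_mul_inv, le_div_iff₀ (exp_pos _)]
      exact h3
    linarith
  refine tendsto_order.2 ⟨fun a ha => ?_, fun a ha => ?_⟩
  · filter_upwards [eventually_ge_atTop T] with t ht using ha.trans_le (hE0 t ht)
  · filter_upwards [hup (a / 2) (by positivity)] with t ht
    linarith

theorem tikhonov_saddle_monotone {X Y : Type*} [NormedAddCommGroup X] [InnerProductSpace ℝ X]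
    [CompleteSpace X] [NormedAddCommGroup Y] [InnerProductSpace ℝ Y] [CompleteSpace Y]
    {f : X → ℝ} {f' : X → X} (hf : ∀ u, HasGradientAt f (f' u) u)
    (hconv : ConvexOn ℝ Set.univ f) (A : X →L[ℝ] Y) {b : Y} {e₁ e₂ : ℝ} {x₁ x₂ : X} {l₁ l₂ : Y}
    (hx₁ : f' x₁ + ContinuousLinearMap.adjoint A l₁ + e₁ • x₁ = 0)
    (hx₂ : f' x₂ + ContinuousLinearMap.adjoint A l₂ + e₂ • x₂ = 0)
    (hl₁ : A x₁ - b - e₁ • l₁ = 0) (hl₂ : A x₂ - b - e₂ • l₂ = 0) :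
    ⟪e₁ • x₁ - e₂ • x₂, x₁ - x₂⟫ + ⟪e₁ • l₁ - e₂ • l₂, l₁ - l₂⟫ ≤ 0 := by
  have h1 := hconv.add_inner_gradient_le (hf x₁) x₂
  have h2 := hconv.add_inner_gradient_le (hf x₂) x₁
  have e1 : e₁ • x₁ = -f' x₁ - ContinuousLinearMap.adjoint A l₁ := by
    rw [← sub_eq_zero, ← hx₁]; abel
  have e2 : e₂ • x₂ = -f' x₂ - ContinuousLinearMap.adjoint A l₂ := by
    rw [← sub_eq_zero, ← hx₂]; abel
  rw [← sub_eq_zero.1 hl₁, ← sub_eq_zero.1 hl₂, e1, e2]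
  simp only [inner_sub_left, inner_sub_right, inner_neg_left,
    ContinuousLinearMap.adjoint_inner_left] at h1 h2 ⊢
  simp only [real_inner_comm l₁, real_inner_comm l₂]
  linarith

theorem tikhonov_saddle_inner_nonneg {X Y : Type*} [NormedAddCommGroup X]
    [InnerProductSpace ℝ X] [CompleteSpace X] [NormedAddCommGroup Y] [InnerProductSpace ℝ Y]
    [CompleteSpace Y] {f : X → ℝ} {f' : X → X} (hf : ∀ u, HasGradientAt f (f' u) u)
    (hconv : ConvexOn ℝ Set.univ f) (A : X →L[ℝ] Y) {b : Y} {e : ℝ} (he : 0 < e)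
    {x₁ xs : X} {l₁ ls : Y}
    (hx₁ : f' x₁ + ContinuousLinearMap.adjoint A l₁ + e • x₁ = 0)
    (hl₁ : A x₁ - b - e • l₁ = 0) (hb : A xs = b)
    (hs : ∀ u, f xs ≤ f u + ⟪ls, A u - b⟫) :
    0 ≤ ⟪x₁, xs - x₁⟫ + ⟪l₁, ls - l₁⟫ := by
  have h1 := hconv.add_inner_gradient_le (hf x₁) xs
  have h2 := hs x₁
  have e1 : f' x₁ = -(e • x₁) - ContinuousLinearMap.adjoint A l₁ := by
    rw [← sub_eq_zero, ← hx₁]; abel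
  have e3 : A x₁ = b + e • l₁ := by rw [← sub_eq_zero, ← hl₁]; abel
  rw [e1] at h1
  refine le_of_mul_le_mul_left (a := e) ?_ he
  rw [mul_zero]
  simp only [inner_sub_left, inner_sub_right, inner_neg_left, inner_add_right,
    ContinuousLinearMap.adjoint_inner_left, real_inner_smul_left, real_inner_smul_right,
    e3, hb] at h1 h2 ⊢
  rw [real_inner_comm ls l₁]
  linarith

theorem regularized_saddle_path {X Y : Type*} [NormedAddCommGroup X]
    [InnerProductSpace ℝ X] [CompleteSpace X] [NormedAddCommGroup Y] [InnerProductSpace ℝ Y]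
    [CompleteSpace Y] {f : X → ℝ} {f' : X → X} (hf : ∀ u, HasGradientAt f (f' u) u)
    (hconv : ConvexOn ℝ Set.univ f) (A : X →L[ℝ] Y) {b : Y} {e : ℝ → ℝ} {t₀ : ℝ}
    (hpos : ∀ t ≥ t₀, 0 < e t) (hanti : StrictAntiOn e (Set.Ici t₀))
    (hlim : Tendsto e atTop (𝓝 0)) {xt : ℝ → X} {lt : ℝ → Y}
    (hxt : ∀ t ≥ t₀, f' (xt t) + ContinuousLinearMap.adjoint A (lt t) + e t • xt t = 0)
    (hlt : ∀ t ≥ t₀, A (xt t) - b - e t • lt t = 0)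
    {xs : X} {ls : Y} (hb : A xs = b) (hs : ∀ u, f xs ≤ f u + ⟪ls, A u - b⟫)
    (hmin : ∀ u μ, A u = b → (∀ v, f u ≤ f v + ⟪μ, A v - b⟫) →
      ‖xs‖ ^ 2 + ‖ls‖ ^ 2 ≤ ‖u‖ ^ 2 + ‖μ‖ ^ 2) :
    Tendsto xt atTop (𝓝 xs) ∧ Tendsto lt atTop (𝓝 ls) ∧
    ∃ R > 0, (∀ t ≥ t₀, ‖xt t‖ ≤ R) ∧
      ∀ t₁ ≥ t₀, ∀ t₂ ≥ t₀, e t₂ * ‖xt t₂ - xt t₁‖ ≤ |e t₁ - e t₂| * R ∧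
        e t₂ * ‖lt t₂ - lt t₁‖ ≤ |e t₁ - e t₂| * R := by
  set z : ℝ → WithLp 2 (X × Y) := fun t => WithLp.toLp 2 (xt t, lt t) with hz
  set zs : WithLp 2 (X × Y) := WithLp.toLp 2 (xs, ls) with hzs
  have hmono : ∀ t₁ ≥ t₀, ∀ t₂ ≥ t₀, ⟪e t₁ • z t₁ - e t₂ • z t₂, z t₁ - z t₂⟫ ≤ 0 := by
    intro t₁ h1 t₂ h2
    simpa [hz, WithLp.prod_inner_apply] using
      tikhonov_saddle_monotone hf hconv A (hxt t₁ h1) (hxt t₂ h2) (hlt t₁ h1) (hlt t₂ h2)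
  have hinner : ∀ t ≥ t₀, 0 ≤ ⟪z t, zs - z t⟫ := by
    intro t ht
    simpa [hz, hzs, WithLp.prod_inner_apply] using
      tikhonov_saddle_inner_nonneg hf hconv A (hpos t ht) (hxt t ht) (hlt t ht) hb hs
  have hbdd : ∀ t ≥ t₀, ‖z t‖ ≤ ‖zs‖ := by
    intro t ht
    have h := hinner t ht
    rw [inner_sub_right, real_inner_self_eq_norm_sq] at h
    have h2 := real_inner_le_norm (z t) zs
    rcases (norm_nonneg (z t)).eq_or_lt with h0 | h0
    · rw [← h0]; exact norm_nonneg _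
    · refine le_of_mul_le_mul_left ?_ h0
      nlinarith
  obtain ⟨w, hw⟩ := tikhonov_path_tendsto hpos hanti hmono hbdd
  have hw1 : Tendsto xt atTop (𝓝 w.fst) :=
    ((WithLp.continuous_fst 2 X Y).tendsto w).comp hw
  have hw2 : Tendsto lt atTop (𝓝 w.snd) :=
    ((WithLp.continuous_snd 2 X Y).tendsto w).comp hw
  have hAw : A w.fst = b := by
    have h1 : Tendsto (fun t => A (xt t) - b - e t • lt t) atTop
        (𝓝 (A w.fst - b - (0 : ℝ) • w.snd)) :=
      (((A.continuous.tendsto _).comp hw1).sub_const b).sub (hlim.smul hw2)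
    have h2 : Tendsto (fun t => A (xt t) - b - e t • lt t) atTop (𝓝 0) :=
      tendsto_const_nhds.congr' (by
        filter_upwards [eventually_ge_atTop t₀] with t ht using (hlt t ht).symm)
    have h3 := tendsto_nhds_unique h1 h2
    rw [zero_smul, sub_zero, sub_eq_zero] at h3
    exact h3
  have hsw : ∀ v, f w.fst ≤ f v + ⟪w.snd, A v - b⟫ := by
    intro v
    have h1 : Tendsto (fun t => f (xt t) + (⟪lt t, A (xt t) - A v⟫ + e t * ⟪xt t, xt t - v⟫))
        atTop (𝓝 (f w.fst + (⟪w.snd, A w.fst - A v⟫ + 0 * ⟪w.fst, w.fst - v⟫))) := by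
      refine (((hf w.fst).continuousAt.tendsto).comp hw1).add (Tendsto.add ?_ (hlim.mul ?_))
      · exact hw2.inner (((A.continuous.tendsto _).comp hw1).sub_const _)
      · exact hw1.inner (hw1.sub_const _)
    have h2 : f w.fst + (⟪w.snd, A w.fst - A v⟫ + 0 * ⟪w.fst, w.fst - v⟫) ≤ f v := by
      refine le_of_tendsto h1 ?_
      filter_upwards [eventually_ge_atTop t₀] with t ht
      have h := hconv.add_inner_gradient_le (hf (xt t)) v
      have e1 : f' (xt t) = -(e t • xt t) - ContinuousLinearMap.adjoint A (lt t) := by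
        rw [← sub_eq_zero, ← hxt t ht]; abel
      rw [e1] at h
      simp only [inner_sub_left, inner_sub_right, inner_neg_left,
        ContinuousLinearMap.adjoint_inner_left, real_inner_smul_left] at h ⊢
      linarith
    rw [hAw, inner_sub_right] at h2
    rw [inner_sub_right]
    linarith
  have hws : w = zs := by
    have h1 : 0 ≤ ⟪w, zs - w⟫ := by
      refine ge_of_tendsto (hw.inner (tendsto_const_nhds.sub hw)) ?_
      filter_upwards [eventually_ge_atTop t₀] with t ht using hinner t ht
    have h2 : ‖zs‖ ^ 2 ≤ ‖w‖ ^ 2 := by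
      rw [WithLp.prod_norm_sq_eq_of_L2, WithLp.prod_norm_sq_eq_of_L2]
      exact hmin _ _ hAw hsw
    have h3 : ‖w - zs‖ ^ 2 ≤ 0 := by
      rw [inner_sub_right, real_inner_self_eq_norm_sq] at h1
      rw [norm_sub_sq_real]
      linarith
    have h4 : ‖w - zs‖ = 0 := by
      have := sq_nonneg ‖w - zs‖
      exact pow_eq_zero_iff (two_ne_zero) |>.1 (le_antisymm h3 this)
    exact sub_eq_zero.1 (norm_eq_zero.1 h4)
  refine ⟨by rw [hws] at hw1; exact hw1, by rw [hws] at hw2; exact hw2, ‖zs‖ + 1,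
    by positivity, ?_, ?_⟩
  · intro t ht
    have h := WithLp.norm_fst_le (p := 2) (x := z t)
    exact (h.trans (hbdd t ht)).trans (by linarith)
  · intro t₁ h1 t₂ h2
    have h3 : e t₂ * ‖z t₂ - z t₁‖ ≤ |e t₁ - e t₂| * (‖zs‖ + 1) :=
      (tikhonov_norm_sub_le (hmono t₁ h1 t₂ h2)).trans
        (mul_le_mul_of_nonneg_left ((hbdd t₁ h1).trans (by linarith)) (abs_nonneg _))
    have h4 := (hpos t₂ h2).le
    exact ⟨(mul_le_mul_of_nonneg_left (WithLp.norm_fst_le (p := 2) (x := z t₂ - z t₁)) h4).trans h3,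
      (mul_le_mul_of_nonneg_left (WithLp.norm_snd_le (p := 2) (x := z t₂ - z t₁)) h4).trans h3⟩

/-- A local Lipschitz comparison bounds the derivative. -/
theorem norm_deriv_le_of_weighted_lipschitz {V : Type*} [NormedAddCommGroup V] [NormedSpace ℝ V]
    {z : ℝ → V} {z' : V} {e : ℝ → ℝ} {e' t t₀ R : ℝ} (ht : t₀ < t) (hz : HasDerivAt z z' t)
    (he : HasDerivAt e e' t)
    (h : ∀ t₂ ≥ t₀, e t₂ * ‖z t₂ - z t‖ ≤ |e t - e t₂| * R) : e t * ‖z'‖ ≤ |e'| * R := by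
  have h1 := (hasDerivAt_iff_tendsto_slope.1 hz).norm
  have h2 := (hasDerivAt_iff_tendsto_slope.1 he).abs
  have h3 : Tendsto e (𝓝[≠] t) (𝓝 (e t)) := he.continuousAt.tendsto.mono_left nhdsWithin_le_nhds
  refine le_of_tendsto_of_tendsto (h3.mul h1) (h2.mul_const R) ?_
  have h4 : ∀ᶠ τ in 𝓝[≠] t, t₀ < τ := nhdsWithin_le_nhds (eventually_gt_nhds ht)
  filter_upwards [h4, self_mem_nhdsWithin] with τ h5 h6
  have h7 := h τ h5.le
  have h8 : 0 < |(τ - t)⁻¹| := abs_pos.2 (inv_ne_zero (sub_ne_zero.2 h6))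
  rw [slope_def_module, slope_def_module, norm_smul, smul_eq_mul, abs_mul, Real.norm_eq_abs,
    abs_sub_comm (e τ)]
  nlinarith

theorem mul_le_young {B X p : ℝ} (hp : 0 < p) : B * X ≤ p * X ^ 2 + B ^ 2 / (4 * p) := by
  have h : p * X ^ 2 + B ^ 2 / (4 * p) - B * X = (2 * p * X - B) ^ 2 / (4 * p) := by
    field_simp
    ring
  have : 0 ≤ (2 * p * X - B) ^ 2 / (4 * p) := by positivity
  linarith

/-- Derivative of the Lyapunov function along a trajectory, after cancellation and
Cauchy-Schwarz. Here `ξ`, `η` are the deviations from the regularized saddle point, `w` is the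
gradient of the regularized Lagrangian at `(x, λ_t)`, and `y`, `l` are the velocities of the
regularized saddle point. -/
theorem lyapunov_deriv_le {X Y : Type*} [NormedAddCommGroup X] [InnerProductSpace ℝ X]
    [CompleteSpace X] [NormedAddCommGroup Y] [InnerProductSpace ℝ Y] [CompleteSpace Y]
    (A : X →L[ℝ] Y) {ξ v w y x₀ x₁ : X} {η l : Y}
    {ν γ Q m μ μ₁ δ a a₁ ε ε₁ h B R θ : ℝ}
    (hν : 0 < ν) (hγ : 0 < γ) (hQ : 0 < Q) (hm : 0 < m) (hμ : 0 < μ) (hδ : 0 < δ) (ha : 0 ≤ a)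
    (ha_eq : a = m * Q * δ + μ * γ * Q) (hθ : ν * δ * θ = a)
    (hε₁ : ε₁ ≤ 0) (hx₀ : ‖x₀‖ ≤ R)
    (hy : ‖y‖ ≤ B) (hl : ‖l‖ ≤ B)
    (hw : h + ε / 2 * ‖ξ‖ ^ 2 ≤ ⟪w, ξ⟫) :
    a₁ * h + a * (⟪w, v⟫ + ⟪l, A ξ⟫ + ε₁ / 2 * (‖x₁‖ ^ 2 - ‖x₀‖ ^ 2))
      + ⟪ν • ξ + Q • (m • v + γ • (w + ContinuousLinearMap.adjoint A η)),
          -(μ • v) - δ • (w + ContinuousLinearMap.adjoint A η) - ν • y⟫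
      + ν / 2 * (μ₁ * ‖ξ‖ ^ 2 + 2 * μ * ⟪ξ, v - y⟫)
      + ⟪η, (ν * δ) • (A ξ + θ • A v - ε • η) - l⟫
    ≤ a₁ * h + a * (B * ‖A‖ * ‖ξ‖ + |ε₁| / 2 * R ^ 2) - μ * (m * Q) * ‖v‖ ^ 2
      - γ * Q * δ * ‖w + ContinuousLinearMap.adjoint A η‖ ^ 2
      - ν * δ * (h + ε / 2 * ‖ξ‖ ^ 2) - ν * δ * ε * ‖η‖ ^ 2
      + ν * B * (ν * ‖ξ‖ + m * Q * ‖v‖ + γ * Q * ‖w + ContinuousLinearMap.adjoint A η‖)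
      + ν / 2 * |μ₁| * ‖ξ‖ ^ 2 + ν * μ * B * ‖ξ‖ + B * ‖η‖ := by
  set g := w + ContinuousLinearMap.adjoint A η with hg
  have hB : 0 ≤ B := (norm_nonneg _).trans hy
  have hgv : ⟪g, v⟫ = ⟪w, v⟫ + ⟪η, A v⟫ := by
    rw [hg, inner_add_left, ContinuousLinearMap.adjoint_inner_left]
  have hgξ : ⟪g, ξ⟫ = ⟪w, ξ⟫ + ⟪η, A ξ⟫ := by
    rw [hg, inner_add_left, ContinuousLinearMap.adjoint_inner_left]
  have hid : a₁ * h + a * (⟪w, v⟫ + ⟪l, A ξ⟫ + ε₁ / 2 * (‖x₁‖ ^ 2 - ‖x₀‖ ^ 2))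
      + ⟪ν • ξ + Q • (m • v + γ • g), -(μ • v) - δ • g - ν • y⟫
      + ν / 2 * (μ₁ * ‖ξ‖ ^ 2 + 2 * μ * ⟪ξ, v - y⟫)
      + ⟪η, (ν * δ) • (A ξ + θ • A v - ε • η) - l⟫
      = a₁ * h + a * (⟪l, A ξ⟫ + ε₁ / 2 * (‖x₁‖ ^ 2 - ‖x₀‖ ^ 2)) - μ * (m * Q) * ‖v‖ ^ 2
      - γ * Q * δ * ‖g‖ ^ 2 - ν * δ * ⟪w, ξ⟫ - ν * δ * ε * ‖η‖ ^ 2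
      - ν * (ν * ⟪ξ, y⟫ + m * Q * ⟪v, y⟫ + γ * Q * ⟪g, y⟫)
      + ν / 2 * μ₁ * ‖ξ‖ ^ 2 - ν * μ * ⟪ξ, y⟫ - ⟪η, l⟫ := by
    simp only [inner_add_left, inner_add_right, inner_sub_right, inner_neg_right,
      real_inner_smul_left, real_inner_smul_right, real_inner_self_eq_norm_sq, smul_add]
    rw [real_inner_comm g v, real_inner_comm g ξ, hgv, hgξ]
    linear_combination (⟪w, v⟫ + ⟪η, A v⟫) * ha_eq + ⟪η, A v⟫ * hθ
  rw [hid]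
  have b1 : ⟪l, A ξ⟫ ≤ B * ‖A‖ * ‖ξ‖ := by
    calc ⟪l, A ξ⟫ ≤ ‖l‖ * ‖A ξ‖ := real_inner_le_norm _ _
      _ ≤ B * (‖A‖ * ‖ξ‖) := mul_le_mul hl (A.le_opNorm _) (norm_nonneg _) hB
      _ = _ := by ring
  have b2 : ε₁ / 2 * (‖x₁‖ ^ 2 - ‖x₀‖ ^ 2) ≤ |ε₁| / 2 * R ^ 2 := by
    rw [abs_of_nonpos hε₁]
    have h1 : ‖x₀‖ ^ 2 ≤ R ^ 2 := pow_le_pow_left₀ (norm_nonneg _) hx₀ 2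
    nlinarith [sq_nonneg ‖x₁‖]
  have hbd : ∀ u : X, -⟪u, y⟫ ≤ B * ‖u‖ := by
    intro u
    have h1 := neg_le_of_abs_le (abs_real_inner_le_norm u y)
    have h2 := mul_le_mul_of_nonneg_left hy (norm_nonneg u)
    linarith
  have b3 : -⟪η, l⟫ ≤ B * ‖η‖ := by
    have h1 := neg_le_of_abs_le (abs_real_inner_le_norm η l)
    have h2 := mul_le_mul_of_nonneg_left hl (norm_nonneg η)
    linarith
  have c1 := mul_le_mul_of_nonneg_left (add_le_add b1 b2) ha
  have c2 := mul_le_mul_of_nonneg_left hw (mul_pos hν hδ).le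
  have c3 := mul_le_mul_of_nonneg_left (hbd ξ) (mul_pos hν hν).le
  have c4 := mul_le_mul_of_nonneg_left (hbd v) (mul_pos hν (mul_pos hm hQ)).le
  have c5 := mul_le_mul_of_nonneg_left (hbd g) (mul_pos hν (mul_pos hγ hQ)).le
  have c6 := mul_le_mul_of_nonneg_left (hbd ξ) (mul_pos hν hμ).le
  have c7 := mul_le_mul_of_nonneg_left (le_abs_self μ₁)
    (mul_nonneg (half_pos hν).le (sq_nonneg ‖ξ‖))
  linarith

set_option maxHeartbeats 1000000 in
/-- The scalar estimate turning the dissipation bound into exponential-type decay. -/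
theorem lyapunov_scalar_estimate {ν γ Q D S M k μ μ₁ δ a a₁ Ca ε ε₁ c C₁ h B C N R κ X Y V G : ℝ}
    (hν : 0 < ν) (hγ : 0 < γ) (hQ : 0 < Q) (hQD : Q ≤ D) (hD : 1 ≤ D) (hS : 0 < S)
    (hM : 0 ≤ M) (hMk : M ≤ k) (hμl : 1 / 2 ≤ μ) (hμu : μ ≤ 2) (hμ₁ : |μ₁| ≤ D * ε / 16)
    (hδ : D / 2 ≤ δ) (ha₁ : a₁ ≤ ν / 4 * D) (ha : 0 ≤ a) (haC : a ≤ Ca * D)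
    (hε : 0 < ε) (hεc : ε ≤ c) (hε₁ : |ε₁| ≤ C₁ * ε * S) (hh : 0 ≤ h) (hX : 0 ≤ X)
    (hC : 0 ≤ C) (hB : B = C * S) (hN : 0 ≤ N) (hκ : 0 ≤ κ)
    (hκa : κ * Ca ≤ ν / 4) (hκk : κ * (6 * k) ≤ 1) (hκγ : κ * (6 * γ) ≤ 1)
    (hκX : κ * (3 / 2 * ν + 1) ≤ D * ε / 16) (hκY : κ ≤ ν / 2 * (D * ε)) :
    a₁ * h + a * (B * N * X + |ε₁| / 2 * R ^ 2) - μ * M * V ^ 2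
      - γ * Q * δ * G ^ 2
      - ν * δ * (h + ε / 2 * X ^ 2) - ν * δ * ε * Y ^ 2
      + ν * B * (ν * X + M * V + γ * Q * G)
      + ν / 2 * |μ₁| * X ^ 2 + ν * μ * B * X + B * Y
      + κ * (a * h + 3 / 2 * (ν ^ 2 * X ^ 2 + M ^ 2 * V ^ 2 + γ ^ 2 * Q ^ 2 * G ^ 2)
        + ν * X ^ 2 + Y ^ 2 / 2)
    ≤ (2 * (C * (Ca * N + ν ^ 2 + 2 * ν)) ^ 2 / ν + C ^ 2 / ν + c * (ν ^ 2 * C ^ 2 * (k + γ))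
        + Ca * C₁ * R ^ 2 / 2) * (D * S ^ 2 / ε + D * S * ε) := by
  have hD0 : 0 < D := by linarith
  have hDε : 0 < D * ε := mul_pos hD0 hε
  have hc : 0 < c := hε.trans_le hεc
  have hk : 0 ≤ k := hM.trans hMk
  have hCa : 0 ≤ Ca := nonneg_of_mul_nonneg_left (ha.trans haC) hD0
  have hB0 : 0 ≤ B := hB ▸ mul_nonneg hC hS.le
  have hC₁ : 0 ≤ C₁ * (ε * S) := by
    rw [← mul_assoc]; exact (abs_nonneg _).trans hε₁
  have hC₁' : 0 ≤ C₁ := nonneg_of_mul_nonneg_left hC₁ (mul_pos hε hS)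
  set F := D * S ^ 2 / ε with hF
  have hF0 : 0 ≤ F := by positivity
  have hW0 : 0 ≤ D * S * ε := by positivity
  have hS2F : S ^ 2 ≤ c * F := by
    rw [hF, ← mul_div_assoc, le_div_iff₀ hε]
    have h1 : ε ≤ c * D := hεc.trans (by nlinarith)
    nlinarith [sq_nonneg S]
  -- the primal-dual gap
  have ph : a₁ * h - ν * δ * h + κ * (a * h) ≤ 0 := by
    have h1 : κ * a ≤ ν / 4 * D := by
      calc κ * a ≤ κ * (Ca * D) := mul_le_mul_of_nonneg_left haC hκ
        _ = κ * Ca * D := by ring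
        _ ≤ _ := mul_le_mul_of_nonneg_right hκa hD0.le
    have h2 : ν * (D / 2) ≤ ν * δ := mul_le_mul_of_nonneg_left hδ hν.le
    have h3 : (a₁ - ν * δ + κ * a) * h ≤ 0 :=
      mul_nonpos_of_nonpos_of_nonneg (by linarith) hh
    linarith
  -- the primal deviation
  have pX : a * (B * N * X) - ν * δ * (ε / 2 * X ^ 2) + ν * B * (ν * X) + ν / 2 * |μ₁| * X ^ 2
      + ν * μ * B * X + κ * (3 / 2 * (ν ^ 2 * X ^ 2) + ν * X ^ 2)
      ≤ 2 * (C * (Ca * N + ν ^ 2 + 2 * ν)) ^ 2 / ν * F := by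
    set CB := C * (Ca * N + ν ^ 2 + 2 * ν) with hCB
    have h1 : (a * N + ν ^ 2 + ν * μ) * B ≤ CB * (D * S) := by
      have e1 : a * N ≤ Ca * D * N := mul_le_mul_of_nonneg_right haC hN
      have e2 : ν ^ 2 ≤ ν ^ 2 * D := le_mul_of_one_le_right (sq_nonneg _) hD
      have e3 : ν * μ ≤ 2 * ν * D := by
        have : ν * μ ≤ ν * 2 := mul_le_mul_of_nonneg_left hμu hν.le
        nlinarith
      calc (a * N + ν ^ 2 + ν * μ) * B ≤ (Ca * D * N + ν ^ 2 * D + 2 * ν * D) * B :=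
            mul_le_mul_of_nonneg_right (by linarith) hB0
        _ = CB * (D * S) := by rw [hB, hCB]; ring
    have h2 : CB * (D * S) * X ≤ ν / 8 * (D * ε) * X ^ 2 + 2 * CB ^ 2 / ν * F := by
      refine (mul_le_young (p := ν / 8 * (D * ε)) (by positivity)).trans (le_of_eq ?_)
      rw [hF]; field_simp; ring
    have h3 := mul_le_mul_of_nonneg_right h1 hX
    have h4 : ν * (D / 2) * (ε / 2 * X ^ 2) ≤ ν * δ * (ε / 2 * X ^ 2) :=
      mul_le_mul_of_nonneg_right (mul_le_mul_of_nonneg_left hδ hν.le) (by positivity)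
    have h5 : ν / 2 * |μ₁| * X ^ 2 ≤ ν / 2 * (D * ε / 16) * X ^ 2 :=
      mul_le_mul_of_nonneg_right (mul_le_mul_of_nonneg_left hμ₁ (by positivity)) (sq_nonneg _)
    have h6 := mul_le_mul_of_nonneg_right hκX (mul_nonneg hν.le (sq_nonneg X))
    have h7 : 0 ≤ ν * (D * ε) * X ^ 2 := by positivity
    linarith
  -- the dual deviation
  have pY : -(ν * δ * ε * Y ^ 2) + B * Y + κ * (Y ^ 2 / 2) ≤ C ^ 2 / ν * F := by
    have h1 : C * S * Y ≤ ν / 4 * (D * ε) * Y ^ 2 + C ^ 2 * S ^ 2 / (ν * (D * ε)) := by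
      refine (mul_le_young (p := ν / 4 * (D * ε)) (by positivity)).trans (le_of_eq ?_)
      field_simp
    have h2 : C ^ 2 * S ^ 2 / (ν * (D * ε)) ≤ C ^ 2 / ν * F := by
      have e1 : C ^ 2 / ν * F = C ^ 2 * S ^ 2 / (ν * (D * ε)) * D ^ 2 := by
        rw [hF]; field_simp
      rw [e1]
      exact le_mul_of_one_le_right (by positivity) (one_le_pow₀ hD)
    have h3 : ν * (D / 2) * ε * Y ^ 2 ≤ ν * δ * ε * Y ^ 2 :=
      mul_le_mul_of_nonneg_right (mul_le_mul_of_nonneg_right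
        (mul_le_mul_of_nonneg_left hδ hν.le) hε.le) (sq_nonneg _)
    have h4 := mul_le_mul_of_nonneg_right hκY (sq_nonneg Y)
    rw [hB]
    linarith
  -- the velocity
  have pV : -(μ * M * V ^ 2) + ν * B * (M * V) + κ * (3 / 2 * (M ^ 2 * V ^ 2))
      ≤ c * (ν ^ 2 * C ^ 2 * k) * F := by
    have h0 : 0 ≤ M * V ^ 2 := by positivity
    have h1 : ν * B * V ≤ 1 / 4 * V ^ 2 + ν ^ 2 * C ^ 2 * S ^ 2 := by
      refine (mul_le_young (p := 1 / 4) (by positivity)).trans (le_of_eq ?_)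
      rw [hB]; ring
    have h2 := mul_le_mul_of_nonneg_left h1 hM
    have h3 : M * (ν ^ 2 * C ^ 2 * S ^ 2) ≤ k * (ν ^ 2 * C ^ 2 * (c * F)) :=
      mul_le_mul hMk (mul_le_mul_of_nonneg_left hS2F (by positivity)) (by positivity) hk
    have h4 : 1 / 2 * (M * V ^ 2) ≤ μ * (M * V ^ 2) := mul_le_mul_of_nonneg_right hμl h0
    have h5 : κ * (6 * M) ≤ 1 :=
      (mul_le_mul_of_nonneg_left (by linarith) hκ).trans hκk
    have h6 := mul_le_mul_of_nonneg_right h5 h0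
    linarith
  -- the gradient
  have pG : -(γ * Q * δ * G ^ 2) + ν * B * (γ * Q * G) + κ * (3 / 2 * (γ ^ 2 * Q ^ 2 * G ^ 2))
      ≤ c * (ν ^ 2 * C ^ 2 * γ) * F := by
    have h0 : 0 ≤ γ * Q * G ^ 2 := by positivity
    have h1 : ν * B * G ≤ D / 4 * G ^ 2 + ν ^ 2 * C ^ 2 * S ^ 2 / D := by
      refine (mul_le_young (p := D / 4) (by positivity)).trans (le_of_eq ?_)
      rw [hB]; field_simp
    have h2 := mul_le_mul_of_nonneg_left h1 (mul_pos hγ hQ).le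
    have h3 : γ * Q * (ν ^ 2 * C ^ 2 * S ^ 2 / D) ≤ γ * (ν ^ 2 * C ^ 2 * (c * F)) := by
      have e1 : γ * Q * (ν ^ 2 * C ^ 2 * S ^ 2 / D) = γ * (ν ^ 2 * C ^ 2 * S ^ 2) * (Q / D) := by
        field_simp
      rw [e1]
      refine (mul_le_of_le_one_right (by positivity) ((div_le_one hD0).2 hQD)).trans ?_
      exact mul_le_mul_of_nonneg_left (mul_le_mul_of_nonneg_left hS2F (by positivity)) hγ.le
    have h4 : γ * Q * (D / 2) * G ^ 2 ≤ γ * Q * δ * G ^ 2 :=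
      mul_le_mul_of_nonneg_right (mul_le_mul_of_nonneg_left hδ (by positivity)) (sq_nonneg _)
    have h5 : κ * (6 * γ) * Q ≤ D := by
      refine le_trans ?_ hQD
      exact mul_le_of_le_one_left hQ.le hκγ
    have h6 := mul_le_mul_of_nonneg_right h5 h0
    linarith
  have pR : a * (|ε₁| / 2 * R ^ 2) ≤ Ca * C₁ * R ^ 2 / 2 * (D * S * ε) := by
    have h1 : |ε₁| / 2 * R ^ 2 ≤ C₁ * ε * S / 2 * R ^ 2 :=
      mul_le_mul_of_nonneg_right (by linarith) (sq_nonneg _)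
    calc a * (|ε₁| / 2 * R ^ 2) ≤ Ca * D * (C₁ * ε * S / 2 * R ^ 2) :=
          mul_le_mul haC h1 (by positivity) (by positivity)
      _ = _ := by ring
  set N₁ := 2 * (C * (Ca * N + ν ^ 2 + 2 * ν)) ^ 2 / ν
  have hN₁ : 0 ≤ N₁ := by positivity
  have r1 : 0 ≤ (N₁ + C ^ 2 / ν + c * (ν ^ 2 * C ^ 2 * (k + γ))) * (D * S * ε) := by positivity
  have r2 : 0 ≤ Ca * C₁ * R ^ 2 / 2 * F := by positivity
  linarith only [ph, pX, pY, pV, pG, pR, r1, r2]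

/-- Size of the Lyapunov coefficients, in terms of `Q = t ^ q`, `D = t ^ (q + s)`, `S = t⁻¹`. -/
theorem lyapunov_coefficient_bounds {Q D S m m₁ m₂ k₁ k₂ q s γ ν : ℝ} (hQ : 0 < Q) (hQD : Q ≤ D)
    (hS : 0 < S) (hS1 : S ≤ 1) (hm : 0 < m) (hq : 0 < q) (hs : 0 < s) (hγ : 0 < γ)
    (hk₂ : 0 < k₂) (hM : m * Q ≤ k₁) (hm₁ : |m₁| ≤ k₂ * m * S) (hm₂ : |m₂| ≤ k₂ * m * S ^ 2)
    (hS2 : S * (γ * q) ≤ 1 / 2) (hS3 : S * ((q + k₂) * k₁) ≤ 1 / 2)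
    (hS4 : S * (k₁ * (k₂ + q) + k₁ * (q + s + γ * q * (1 + q))
      + γ * ((q * (k₁ * (k₂ + q) + k₁) + k₁ * k₂ * (q + 1)) + 2 * q)) ≤ ν / 4) :
    let M := m * Q
    let δ := D - γ * q * (Q * S)
    let μ := 1 - q * (M * S) - Q * m₁
    let M₁ := m₁ * Q + m * (q * (Q * S))
    let μ₁ := -(q * (M₁ * S - M * S ^ 2)) - (q * (Q * S) * m₁ + Q * m₂)
    let δ₁ := (q + s) * (D * S) - γ * q * (q * (Q * S) * S - Q * S ^ 2)
    (D / 2 ≤ δ ∧ 1 / 2 ≤ μ ∧ μ ≤ 2 ∧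
      |μ₁| ≤ (q * (k₁ * (k₂ + q) + k₁) + k₁ * k₂ * (q + 1)) * S ^ 2 ∧
      0 ≤ M * δ + μ * γ * Q ∧ M * δ + μ * γ * Q ≤ (k₁ + 2 * γ) * D ∧
      M₁ * δ + M * δ₁ + (μ₁ * γ * Q + μ * γ * (q * (Q * S))) ≤ ν / 4 * D) := by
  intro M δ μ M₁ μ₁ δ₁
  have hD : 0 < D := hQ.trans_le hQD
  have hM0 : 0 < M := mul_pos hm hQ
  have hk₁ : 0 < k₁ := hM0.trans_le hM
  have hSS : S ^ 2 ≤ S := by nlinarith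
  have hQm₁ : |Q * m₁| ≤ k₁ * k₂ * S := by
    rw [abs_mul, abs_of_pos hQ]
    calc Q * |m₁| ≤ Q * (k₂ * m * S) := mul_le_mul_of_nonneg_left hm₁ hQ.le
      _ = M * (k₂ * S) := by simp only [M]; ring
      _ ≤ k₁ * (k₂ * S) := mul_le_mul_of_nonneg_right hM (by positivity)
      _ = _ := by ring
  have hQm₂ : |Q * m₂| ≤ k₁ * k₂ * S ^ 2 := by
    rw [abs_mul, abs_of_pos hQ]
    calc Q * |m₂| ≤ Q * (k₂ * m * S ^ 2) := mul_le_mul_of_nonneg_left hm₂ hQ.le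
      _ = M * (k₂ * S ^ 2) := by simp only [M]; ring
      _ ≤ k₁ * (k₂ * S ^ 2) := mul_le_mul_of_nonneg_right hM (by positivity)
      _ = _ := by ring
  have hMS : M * S ≤ k₁ * S := mul_le_mul_of_nonneg_right hM hS.le
  have hMS0 : 0 < M * S := mul_pos hM0 hS
  have hQS : γ * q * (Q * S) ≤ D / 2 := by
    calc γ * q * (Q * S) = S * (γ * q) * Q := by ring
      _ ≤ 1 / 2 * D := mul_le_mul hS2 hQD hQ.le (by norm_num)
      _ = _ := by ring
  have hQS0 : 0 < γ * q * (Q * S) := by positivity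
  have hδ : D / 2 ≤ δ := by simp only [δ]; linarith
  have hδD : δ ≤ D := by simp only [δ]; linarith
  have hδ0 : 0 < δ := by linarith
  obtain ⟨a1, a2⟩ := abs_le.1 hQm₁
  obtain ⟨b1, b2⟩ := abs_le.1 hQm₂
  have hqMS := mul_le_mul_of_nonneg_left hMS hq.le
  have hqMS0 := mul_pos hq hMS0
  have hμl : 1 / 2 ≤ μ := by simp only [μ]; linarith
  have hμu : μ ≤ 2 := by
    simp only [μ]
    have : 0 ≤ S * (q * k₁) := by positivity
    linarith
  have hM₁ : |M₁| ≤ k₁ * (k₂ + q) * S := by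
    have e : M₁ = Q * m₁ + q * (M * S) := by simp only [M₁, M]; ring
    rw [e, abs_le]
    constructor <;> linarith
  have hμ₁ : |μ₁| ≤ (q * (k₁ * (k₂ + q) + k₁) + k₁ * k₂ * (q + 1)) * S ^ 2 := by
    obtain ⟨c1, c2⟩ := abs_le.1 hM₁
    have d1 := mul_le_mul_of_nonneg_left c1 (mul_pos hq hS).le
    have d2 := mul_le_mul_of_nonneg_left c2 (mul_pos hq hS).le
    have d3 := mul_le_mul_of_nonneg_left a1 (mul_pos hq hS).le
    have d4 := mul_le_mul_of_nonneg_left a2 (mul_pos hq hS).le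
    have d5 := mul_le_mul_of_nonneg_left hMS (mul_pos hq hS).le
    have d6 : 0 < q * S * (M * S) := by positivity
    have d7 : 0 < q * S * (k₁ * S) := by positivity
    have e : μ₁ = -(q * S * M₁) + q * S * (M * S) - q * S * (Q * m₁) - Q * m₂ := by
      simp only [μ₁]; ring
    rw [e, abs_le]
    constructor <;> linarith
  have hδ₁ : |δ₁| ≤ (q + s + γ * q * (1 + q)) * (D * S) := by
    have d1 : Q * S ^ 2 ≤ D * S := mul_le_mul hQD hSS (by positivity) hD.le
    have d2 := mul_le_mul_of_nonneg_left d1 (mul_pos hγ hq).le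
    have d3 := mul_le_mul_of_nonneg_left d2 hq.le
    have d4 : 0 < γ * q * (Q * S ^ 2) := by positivity
    have d5 : 0 < q * (γ * q * (Q * S ^ 2)) := by positivity
    have d6 : 0 < (q + s) * (D * S) := by positivity
    have e : δ₁ = (q + s) * (D * S) - q * (γ * q * (Q * S ^ 2)) + γ * q * (Q * S ^ 2) := by
      simp only [δ₁]; ring
    rw [e, abs_le]
    constructor <;> linarith
  refine ⟨hδ, hμl, hμu, hμ₁, ?_, ?_, ?_⟩
  · have : 0 < μ := by linarith
    positivity
  · have h1 : M * δ ≤ k₁ * D := mul_le_mul hM hδD hδ0.le hk₁.le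
    have h2 : μ * γ * Q ≤ 2 * γ * D :=
      mul_le_mul (mul_le_mul_of_nonneg_right hμu hγ.le) hQD hQ.le (by positivity)
    linarith
  · set cM := k₁ * (k₂ + q)
    set cδ := q + s + γ * q * (1 + q)
    set cμ := q * (cM + k₁) + k₁ * k₂ * (q + 1)
    have hcM : 0 < cM := by positivity
    have hcμ : 0 < cμ := by positivity
    have h1 : M₁ * δ ≤ cM * S * D :=
      (mul_le_mul_of_nonneg_right ((le_abs_self _).trans hM₁) hδ0.le).trans
        (mul_le_mul_of_nonneg_left hδD (by positivity))
    have h2 : M * δ₁ ≤ k₁ * (cδ * (D * S)) :=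
      (mul_le_mul_of_nonneg_left ((le_abs_self _).trans hδ₁) hM0.le).trans
        (mul_le_mul_of_nonneg_right hM (by positivity))
    have h3 : μ₁ * γ * Q ≤ cμ * S * γ * D := by
      have e1 : μ₁ ≤ cμ * S :=
        ((le_abs_self _).trans hμ₁).trans (mul_le_mul_of_nonneg_left hSS hcμ.le)
      exact mul_le_mul (mul_le_mul_of_nonneg_right e1 hγ.le) hQD hQ.le (by positivity)
    have h4 : μ * γ * (q * (Q * S)) ≤ 2 * γ * (q * (D * S)) :=
      mul_le_mul (mul_le_mul_of_nonneg_right hμu hγ.le)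
        (mul_le_mul_of_nonneg_left (mul_le_mul_of_nonneg_right hQD hS.le) hq.le)
        (by positivity) (by positivity)
    have h5 := mul_le_mul_of_nonneg_right hS4 hD.le
    linarith


section PrimalGap

variable {X Y : Type*} [NormedAddCommGroup X] [InnerProductSpace ℝ X] [CompleteSpace X]
  [NormedAddCommGroup Y] [InnerProductSpace ℝ Y] [CompleteSpace Y] {f : X → ℝ} {f' : X → X}

/-- The regularized primal gap dominates the squared distance to the regularized minimizer. -/
theorem regularized_gap_nonneg (hf : ∀ u, HasGradientAt f (f' u) u)
    (hconv : ConvexOn ℝ Set.univ f) (A : X →L[ℝ] Y) {e : ℝ} (he : 0 < e) {u x₁ : X} {l₁ : Y}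
    (hx₁ : f' x₁ + ContinuousLinearMap.adjoint A l₁ + e • x₁ = 0) :
    0 ≤ f u - f x₁ + ⟪l₁, A (u - x₁)⟫ + e / 2 * (‖u‖ ^ 2 - ‖x₁‖ ^ 2) := by
  have h1 := hconv.add_inner_gradient_le (hf x₁) u
  have e1 : f' x₁ = -(e • x₁) - ContinuousLinearMap.adjoint A l₁ := by
    rw [← sub_eq_zero, ← hx₁]; abel
  have h2 : 0 ≤ e / 2 * ‖u - x₁‖ ^ 2 := by positivity
  rw [e1] at h1
  rw [norm_sub_sq_real, real_inner_comm] at h2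
  simp only [inner_sub_left, inner_sub_right, inner_neg_left, map_sub,
    ContinuousLinearMap.adjoint_inner_left, real_inner_smul_left, real_inner_self_eq_norm_sq]
    at h1 h2 ⊢
  linarith

theorem regularized_gap_le_inner (hf : ∀ u, HasGradientAt f (f' u) u)
    (hconv : ConvexOn ℝ Set.univ f) (A : X →L[ℝ] Y) (e : ℝ) (u x₁ : X) (l₁ : Y) :
    f u - f x₁ + ⟪l₁, A (u - x₁)⟫ + e / 2 * (‖u‖ ^ 2 - ‖x₁‖ ^ 2) + e / 2 * ‖u - x₁‖ ^ 2
      ≤ ⟪f' u + ContinuousLinearMap.adjoint A l₁ + e • u, u - x₁⟫ := by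
  have h1 := hconv.add_inner_gradient_le (hf u) x₁
  rw [norm_sub_sq_real]
  simp only [inner_add_left, inner_sub_right, map_sub,
    ContinuousLinearMap.adjoint_inner_left, real_inner_smul_left, real_inner_self_eq_norm_sq]
    at h1 ⊢
  linarith

theorem regularized_gap_hasDerivAt (hf : ∀ u, HasGradientAt f (f' u) u) (A : X →L[ℝ] Y)
    {e : ℝ → ℝ} {e' t : ℝ} {x xt : ℝ → X} {lt : ℝ → Y} {v y : X} {l : Y}
    (he : HasDerivAt e e' t) (hx : HasDerivAt x v t) (hxt : HasDerivAt xt y t)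
    (hlt : HasDerivAt lt l t)
    (hopt : f' (xt t) + ContinuousLinearMap.adjoint A (lt t) + e t • xt t = 0) :
    HasDerivAt (fun τ => f (x τ) - f (xt τ) + ⟪lt τ, A (x τ - xt τ)⟫
        + e τ / 2 * (‖x τ‖ ^ 2 - ‖xt τ‖ ^ 2))
      (⟪f' (x t) + ContinuousLinearMap.adjoint A (lt t) + e t • x t, v⟫ + ⟪l, A (x t - xt t)⟫
        + e' / 2 * (‖x t‖ ^ 2 - ‖xt t‖ ^ 2)) t := by
  have hcomp : ∀ {z : ℝ → X} {z' : X}, HasDerivAt z z' t →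
      HasDerivAt (fun τ => f (z τ)) ⟪f' (z t), z'⟫ t := by
    intro z z' hz
    have h := (hf (z t)).hasFDerivAt.comp_hasDerivAt t hz
    rw [InnerProductSpace.toDual_apply_apply] at h
    exact h
  have hA : HasDerivAt (fun τ => A (x τ - xt τ)) (A (v - y)) t :=
    A.hasFDerivAt.comp_hasDerivAt t (hx.sub hxt)
  have h := (((hcomp hx).sub (hcomp hxt)).add (hlt.inner ℝ hA)).add
    ((he.div_const 2).mul (hx.norm_sq.sub hxt.norm_sq))
  refine h.congr_deriv ?_
  have h0 : ⟪f' (xt t) + ContinuousLinearMap.adjoint A (lt t) + e t • xt t, y⟫ = 0 := by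
    rw [hopt, inner_zero_left]
  simp only [inner_add_left, inner_sub_right, map_sub,
    ContinuousLinearMap.adjoint_inner_left, real_inner_smul_left] at h0 ⊢
  simp only [Pi.sub_apply]
  linear_combination -h0

end PrimalGap

/-- Derivative of the anchored velocity along the second-order dynamics. -/
theorem anchored_velocity_hasDerivAt {X : Type*} [NormedAddCommGroup X] [NormedSpace ℝ X]
    {x x' xt g : ℝ → X} {Q m : ℝ → ℝ} {x'' y g' : X} {Q' m' α γ T t : ℝ} (hQ0 : Q t ≠ 0)
    (hx : HasDerivAt x (x' t) t) (hx' : HasDerivAt x' x'' t) (hxt : HasDerivAt xt y t)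
    (hg : HasDerivAt g g' t) (hQ : HasDerivAt Q Q' t) (hm : HasDerivAt m m' t)
    (hode : m t • x'' + (α / Q t) • x' t + γ • g' + T • g t = 0) :
    HasDerivAt (fun τ => (α - 1) • (x τ - xt τ) + Q τ • (m τ • x' τ + γ • g τ))
      (-((1 - m t * Q' - Q t * m') • x' t) - (Q t * T - γ * Q') • g t - (α - 1) • y) t := by
  have h := ((hx.sub hxt).const_smul (α - 1)).add
    (hQ.smul ((hm.smul hx').add (hg.const_smul γ)))
  refine h.congr_deriv ?_
  have h1 : m t • x'' = -((α / Q t) • x' t) - γ • g' - T • g t := by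
    rw [← sub_eq_zero, ← hode]; module
  have h2 : Q t • ((α / Q t) • x' t) = α • x' t := by
    rw [smul_smul, mul_div_cancel₀ _ hQ0]
  simp only [Pi.add_apply, Pi.smul_apply, Pi.smul_apply']
  have h3 : Q t • (m t • x'') = -(α • x' t) - (Q t * γ) • g' - (Q t * T) • g t := by
    rw [h1, ← h2]; module
  simp only [smul_add, h3]
  module



theorem regularization_hasDerivAt {c p t : ℝ} (ht : 0 < t) :
    HasDerivAt (fun t : ℝ => c / t ^ p) (-(p * (c / t ^ p) * t⁻¹)) t := by
  have h := ((Real.hasDerivAt_rpow_const (x := t) (p := -p) (Or.inl ht.ne')).const_mul c)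
  refine (h.congr_of_eventuallyEq ?_).congr_deriv ?_
  · filter_upwards [eventually_gt_nhds ht] with τ hτ
    rw [rpow_neg hτ.le, div_eq_mul_inv]
  · rw [rpow_sub_one ht.ne', rpow_neg ht.le]
    field_simp

theorem rpow_hasDerivAt {q t : ℝ} (ht : 0 < t) :
    HasDerivAt (fun t : ℝ => t ^ q) (q * (t ^ q * t⁻¹)) t := by
  refine (Real.hasDerivAt_rpow_const (x := t) (p := q) (Or.inl ht.ne')).congr_deriv ?_
  rw [rpow_sub_one ht.ne', div_eq_mul_inv]

theorem sq_add_three_le {n a b c : ℝ} (hn : 0 ≤ n) (h : n ≤ a + b + c) :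
    n ^ 2 / 2 ≤ 3 / 2 * (a ^ 2 + b ^ 2 + c ^ 2) := by
  have h1 : n ^ 2 ≤ (a + b + c) ^ 2 := pow_le_pow_left₀ hn h 2
  nlinarith [sq_nonneg (a - b), sq_nonneg (b - c), sq_nonneg (a - c)]

theorem eventually_mul_le_of_tendsto_zero {ι : Type*} {l : Filter ι} {g : ι → ℝ}
    (hg : Tendsto g l (𝓝 0)) (u : ℝ) {v : ℝ} (hv : 0 < v) : ∀ᶠ i in l, g i * u ≤ v := by
  have h : Tendsto (fun i => g i * u) l (𝓝 0) := by simpa using hg.mul_const u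
  exact h.eventually_le_const hv

theorem tendsto_zero_of_norm_sq_le {Z : Type*} [NormedAddCommGroup Z] {z : ℝ → Z} {E : ℝ → ℝ}
    {k T : ℝ} (hE : Tendsto E atTop (𝓝 0)) (hz : ∀ t ≥ T, ‖z t‖ ^ 2 ≤ k * E t) :
    Tendsto z atTop (𝓝 0) := by
  have h1 : Tendsto (fun t => ‖z t‖ ^ 2) atTop (𝓝 0) := by
    refine squeeze_zero' (Eventually.of_forall fun t => sq_nonneg _)
      ((eventually_ge_atTop T).mono hz) ?_
    simpa using hE.const_mul k
  rw [tendsto_zero_iff_norm_tendsto_zero]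
  simpa [Real.sqrt_sq] using h1.sqrt

set_option maxHeartbeats 2000000 in
theorem trajectory_strong_convergence_to_minimal_norm_solution
    {X Y : Type*} [NormedAddCommGroup X] [InnerProductSpace ℝ X] [CompleteSpace X]
    [NormedAddCommGroup Y] [InnerProductSpace ℝ Y] [CompleteSpace Y]
    (f : X → ℝ) (f' : X → X) (hf : ∀ u, HasGradientAt f (f' u) u)
    (hconv : ConvexOn ℝ Set.univ f)
    (A : X →L[ℝ] Y) (b : Y)
    (L : X → Y → ℝ) (hL : ∀ u lam, L u lam = f u + ⟪lam, A u - b⟫)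
    (c p t₀ : ℝ) (hc : 0 < c) (hp0 : 0 < p) (hp1 : p < 1) (ht₀ : 0 < t₀)
    (Lt : ℝ → X → Y → ℝ)
    (hLt : ∀ t u lam, Lt t u lam = L u lam + (c / (2 * t ^ p)) * (‖u‖ ^ 2 - ‖lam‖ ^ 2))
    (gx : ℝ → X → Y → X)
    (hgx : ∀ t u lam, gx t u lam = f' u + ContinuousLinearMap.adjoint A lam + (c / t ^ p) • u)
    (gl : ℝ → X → Y → Y)
    (hgl : ∀ t u lam, gl t u lam = A u - b - (c / t ^ p) • lam)
    (Om : Set (X × Y))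
    (hOm : Om = {z : X × Y | ∀ u μ, L z.1 μ ≤ L z.1 z.2 ∧ L z.1 z.2 ≤ L u z.2})
    (hOmne : Om.Nonempty)
    (xs : X) (ls : Y)
    (hmem : (xs, ls) ∈ Om)
    (hmin : ∀ w ∈ Om, Real.sqrt (‖xs‖ ^ 2 + ‖ls‖ ^ 2) ≤ Real.sqrt (‖w.1‖ ^ 2 + ‖w.2‖ ^ 2))
    (α q γ s : ℝ) (hα : 1 < α) (hq0 : 0 < q) (hq1 : q < 1) (hγ : 0 < γ) (hs : 0 < s)
    (m m' m'' : ℝ → ℝ)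
    (hmpos : ∀ t ≥ t₀, 0 < m t)
    (hmmono : AntitoneOn m (Set.Ici t₀))
    (hmd : ∀ t ≥ t₀, HasDerivAt m (m' t) t)
    (hmd2 : ∀ t ≥ t₀, HasDerivAt m' (m'' t) t)
    (θ : ℝ → ℝ)
    (hθ : ∀ t, θ t = (m t * t ^ (2*q+s) + γ * t ^ q - 2 * m t * γ * q * t ^ (2*q-1)
      - γ * m' t * t ^ (2*q)) / ((α - 1) * (t ^ (q+s) - γ * q * t ^ (q-1))))
    (k₁ k₂ T₁ T₂ : ℝ) (hk₁ : 0 < k₁) (hk₂ : 0 < k₂) (hT₁ : t₀ ≤ T₁) (hT₂ : t₀ ≤ T₂)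
    (hA1 : ∀ t ≥ T₁, γ / t ^ (q+s) ≤ m t ∧ m t ≤ k₁ / t ^ q)
    (hA2 : ∀ t ≥ T₂, t * |m' t| ≤ k₂ * m t ∧ t ^ 2 * |m'' t| ≤ k₂ * m t)
    (x : ℝ → X) (lam : ℝ → Y) (x' x'' : ℝ → X) (lam' : ℝ → Y) (gder : ℝ → X)
    (hx : ∀ t ≥ t₀, HasDerivAt x (x' t) t)
    (hx' : ∀ t ≥ t₀, HasDerivAt x' (x'' t) t)
    (hx''c : ContinuousOn x'' (Set.Ici t₀))
    (hlam : ∀ t ≥ t₀, HasDerivAt lam (lam' t) t)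
    (hlamc : ContinuousOn lam' (Set.Ici t₀))
    (hgder : ∀ t ≥ t₀, HasDerivAt (fun τ => gx τ (x τ) (lam τ)) (gder t) t)
    (hode1 : ∀ t ≥ t₀, m t • x'' t + (α / t ^ q) • x' t + γ • gder t
      + t ^ s • gx t (x t) (lam t) = 0)
    (hode2 : ∀ t ≥ t₀, lam' t = ((α - 1) * (t ^ (q+s) - γ * q * t ^ (q-1)))
      • gl t (x t + θ t • x' t) (lam t))
    (xt : ℝ → X) (lt : ℝ → Y)
    (hsaddle : ∀ t ≥ t₀, gx t (xt t) (lt t) = 0 ∧ gl t (xt t) (lt t) = 0)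
    (xt' : ℝ → X) (lt' : ℝ → Y)
    (hxt : ∀ t ≥ t₀, HasDerivAt xt (xt' t) t)
    (hlt : ∀ t ≥ t₀, HasDerivAt lt (lt' t) t)
    (hxtc : ContinuousOn xt' (Set.Ici t₀))
    (hltc : ContinuousOn lt' (Set.Ici t₀))
    (hpq : p < 1 - q) (hcond1 : 4*q + s + p - 2 < 0) (hcond2 : 3*q + s - p - 1 < 0) :
    Tendsto (fun t => Real.sqrt (‖x t - xs‖ ^ 2 + ‖lam t - ls‖ ^ 2)) atTop (nhds 0) := by
  have hν : 0 < α - 1 := sub_pos.2 hα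
  set ν := α - 1 with hνdef
  set e : ℝ → ℝ := fun t => c / t ^ p with hedef
  have htpos : ∀ {t : ℝ}, t ≥ t₀ → 0 < t := fun h => ht₀.trans_le h
  have hepos : ∀ t ≥ t₀, 0 < e t := fun t ht => div_pos hc (rpow_pos_of_pos (htpos ht) _)
  have heanti : StrictAntiOn e (Set.Ici t₀) := by
    intro a ha d hd had
    exact div_lt_div_of_pos_left hc (rpow_pos_of_pos (htpos ha) _)
      (rpow_lt_rpow (htpos ha).le had hp0)
  have helim : Tendsto e atTop (𝓝 0) := (tendsto_rpow_atTop hp0).const_div_atTop c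
  have heder : ∀ t ≥ t₀, HasDerivAt e (-(p * e t * t⁻¹)) t :=
    fun t ht => regularization_hasDerivAt (htpos ht)
  -- the limit point and the regularized path
  have hopt : ∀ t ≥ t₀, f' (xt t) + ContinuousLinearMap.adjoint A (lt t) + e t • xt t = 0 := by
    intro t ht
    rw [← hgx]; exact (hsaddle t ht).1
  have hfeas : ∀ t ≥ t₀, A (xt t) - b - e t • lt t = 0 := by
    intro t ht
    rw [← hgl]; exact (hsaddle t ht).2
  have hmem' : ∀ u μ, L xs μ ≤ L xs ls ∧ L xs ls ≤ L u ls := by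
    rw [hOm] at hmem; exact hmem
  have hb : A xs = b := by
    have h := (hmem' xs (ls + (A xs - b))).1
    rw [hL, hL, inner_add_left, real_inner_self_eq_norm_sq] at h
    have h1 : ‖A xs - b‖ ^ 2 = 0 := le_antisymm (by linarith) (sq_nonneg _)
    exact sub_eq_zero.1 (norm_eq_zero.1 ((pow_eq_zero_iff two_ne_zero).1 h1))
  have hs' : ∀ u, f xs ≤ f u + ⟪ls, A u - b⟫ := by
    intro u
    have h := (hmem' u ls).2
    rw [hL, hL, hb, sub_self, inner_zero_right, add_zero] at h
    exact h
  have hmin' : ∀ u μ, A u = b → (∀ v, f u ≤ f v + ⟪μ, A v - b⟫) →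
      ‖xs‖ ^ 2 + ‖ls‖ ^ 2 ≤ ‖u‖ ^ 2 + ‖μ‖ ^ 2 := by
    intro u μ hu hv
    have hin : (u, μ) ∈ Om := by
      rw [hOm]
      intro v μ'
      simp only [hL, hu, sub_self, inner_zero_right, add_zero, le_refl, true_and]
      exact hv v
    exact (Real.sqrt_le_sqrt_iff (by positivity)).1 (hmin (u, μ) hin)
  obtain ⟨hxlim, hllim, R, hR, hxR, hlip⟩ := regularized_saddle_path hf hconv A hepos heanti
    helim hopt hfeas hb hs' hmin'
  have hrate : ∀ t > t₀, ‖xt' t‖ ≤ p * R * t⁻¹ ∧ ‖lt' t‖ ≤ p * R * t⁻¹ := by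
    intro t ht
    have h1 := norm_deriv_le_of_weighted_lipschitz ht (hxt t ht.le) (heder t ht.le)
      (fun t₂ h2 => (hlip t ht.le t₂ h2).1)
    have h2 := norm_deriv_le_of_weighted_lipschitz ht (hlt t ht.le) (heder t ht.le)
      (fun t₂ h2 => (hlip t ht.le t₂ h2).2)
    have he := hepos t ht.le
    have ht' := htpos ht.le
    have h3 : |-(p * e t * t⁻¹)| * R = e t * (p * R * t⁻¹) := by
      rw [abs_neg, abs_of_pos (by positivity)]; ring
    rw [h3] at h1 h2
    exact ⟨le_of_mul_le_mul_left h1 he, le_of_mul_le_mul_left h2 he⟩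
  -- coefficients
  set Q : ℝ → ℝ := fun t => t ^ q with hQdef
  set D : ℝ → ℝ := fun t => t ^ (q + s) with hDdef
  set δ : ℝ → ℝ := fun t => D t - γ * q * (Q t * t⁻¹) with hδdef
  set M : ℝ → ℝ := fun t => m t * Q t with hMdef
  set μ : ℝ → ℝ := fun t => 1 - q * (M t * t⁻¹) - Q t * m' t with hμdef
  set a : ℝ → ℝ := fun t => M t * δ t + μ t * γ * Q t with hadef
  set M₁ : ℝ → ℝ := fun t => m' t * Q t + m t * (q * (Q t * t⁻¹)) with hM₁def
  set δ₁ : ℝ → ℝ := fun t => (q + s) * (D t * t⁻¹)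
    - γ * q * (q * (Q t * t⁻¹) * t⁻¹ - Q t * t⁻¹ ^ 2) with hδ₁def
  set μ₁ : ℝ → ℝ := fun t => -(q * (M₁ t * t⁻¹ - M t * t⁻¹ ^ 2))
    - (q * (Q t * t⁻¹) * m' t + Q t * m'' t) with hμ₁def
  set a₁ : ℝ → ℝ := fun t => M₁ t * δ t + M t * δ₁ t
    + (μ₁ t * γ * Q t + μ t * γ * (q * (Q t * t⁻¹))) with ha₁def
  have hQpos : ∀ t ≥ t₀, 0 < Q t := fun t ht => rpow_pos_of_pos (htpos ht) _
  have hDpos : ∀ t ≥ t₀, 0 < D t := fun t ht => rpow_pos_of_pos (htpos ht) _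
  have hQder : ∀ t ≥ t₀, HasDerivAt Q (q * (Q t * t⁻¹)) t := fun t ht => rpow_hasDerivAt (htpos ht)
  have hSder : ∀ t ≥ t₀, HasDerivAt (fun t : ℝ => t⁻¹) (-t⁻¹ ^ 2) t := fun t ht =>
    (hasDerivAt_inv (htpos ht).ne').congr_deriv (by rw [inv_pow])
  have hMder : ∀ t ≥ t₀, HasDerivAt M (M₁ t) t := fun t ht => (hmd t ht).mul (hQder t ht)
  have hδder : ∀ t ≥ t₀, HasDerivAt δ (δ₁ t) t := by
    intro t ht
    have hDder : HasDerivAt D ((q + s) * (D t * t⁻¹)) t := rpow_hasDerivAt (htpos ht)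
    refine (hDder.sub (((hQder t ht).mul (hSder t ht)).const_mul (γ * q))).congr_deriv ?_
    simp only [hδ₁def]; ring
  have hμder : ∀ t ≥ t₀, HasDerivAt μ (μ₁ t) t := by
    intro t ht
    refine (((((hMder t ht).mul (hSder t ht)).const_mul q).const_sub 1).sub
      ((hQder t ht).mul (hmd2 t ht))).congr_deriv ?_
    simp only [hμ₁def]; ring
  have hader : ∀ t ≥ t₀, HasDerivAt a (a₁ t) t := by
    intro t ht
    exact ((hMder t ht).mul (hδder t ht)).add (((hμder t ht).mul_const γ).mul (hQder t ht))
  -- the Lyapunov function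
  set h : ℝ → ℝ := fun t => f (x t) - f (xt t) + ⟪lt t, A (x t - xt t)⟫
    + e t / 2 * (‖x t‖ ^ 2 - ‖xt t‖ ^ 2) with hhdef
  set w : ℝ → X := fun t => f' (x t) + ContinuousLinearMap.adjoint A (lt t) + e t • x t with hwdef
  set G : ℝ → X := fun t => w t + ContinuousLinearMap.adjoint A (lam t - lt t) with hGdef
  have hG : ∀ t, gx t (x t) (lam t) = G t := by
    intro t
    rw [hgx]
    simp only [hGdef, hwdef, hedef, map_sub]
    abel
  set V : ℝ → X := fun t => ν • (x t - xt t) + Q t • (m t • x' t + γ • G t) with hVdef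
  set E : ℝ → ℝ := fun t => a t * h t + ‖V t‖ ^ 2 / 2 + ν / 2 * (μ t * ‖x t - xt t‖ ^ 2)
    + ‖lam t - lt t‖ ^ 2 / 2 with hEdef
  have hVder : ∀ t ≥ t₀, HasDerivAt V (-(μ t • x' t) - δ t • G t - ν • xt' t) t := by
    intro t ht
    have hg : HasDerivAt G (gder t) t := by
      have h1 := hgder t ht
      rwa [funext hG] at h1
    have hode := hode1 t ht
    rw [hG] at hode
    refine (anchored_velocity_hasDerivAt (hQpos t ht).ne' (hx t ht) (hx' t ht) (hxt t ht) hg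
      (hQder t ht) (hmd t ht) hode).congr_deriv ?_
    have e1 : 1 - m t * (q * (Q t * t⁻¹)) - Q t * m' t = μ t := by
      simp only [hμdef, hMdef]; ring
    have e2 : Q t * t ^ s - γ * (q * (Q t * t⁻¹)) = δ t := by
      simp only [hδdef, hDdef, hQdef, rpow_add (htpos ht)]; ring
    rw [e1, e2]
  have hlamder : ∀ t ≥ t₀, lam' t
      = (ν * δ t) • (A (x t - xt t) + θ t • A (x' t) - e t • (lam t - lt t)) := by
    intro t ht
    have e1 : t ^ (q + s) - γ * q * t ^ (q - 1) = δ t := by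
      simp only [hδdef, hDdef, hQdef, rpow_sub_one (htpos ht).ne', div_eq_mul_inv]
    rw [hode2 t ht, e1, hgl]
    congr 1
    have e2 : A (xt t) = b + e t • lt t := by
      rw [← sub_eq_zero, ← hfeas t ht]; abel
    rw [map_sub, map_add, map_smul, e2, smul_sub]
    abel
  have hθa : ∀ t ≥ t₀, δ t ≠ 0 → ν * δ t * θ t = a t := by
    intro t ht hδ0
    have ht' := htpos ht
    have e1 : t ^ (q + s) - γ * q * t ^ (q - 1) = δ t := by
      simp only [hδdef, hDdef, hQdef, rpow_sub_one ht'.ne', div_eq_mul_inv]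
    rw [hθ, e1, mul_div_cancel₀ _ (mul_ne_zero hν.ne' hδ0)]
    have e2 : t ^ (2 * q) = Q t * Q t := by
      rw [two_mul, rpow_add ht']
    have e3 : t ^ (2 * q + s) = Q t * D t := by
      rw [two_mul, add_assoc, rpow_add ht']
    have e4 : t ^ (2 * q - 1) = Q t * Q t * t⁻¹ := by
      rw [rpow_sub_one ht'.ne', e2, div_eq_mul_inv]
    rw [e2, e3, e4]
    simp only [hadef, hMdef, hδdef, hμdef]
    ring
  have hEder : ∀ t ≥ t₀, HasDerivAt E (a₁ t * h t
      + a t * (⟪w t, x' t⟫ + ⟪lt' t, A (x t - xt t)⟫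
        + -(p * e t * t⁻¹) / 2 * (‖x t‖ ^ 2 - ‖xt t‖ ^ 2))
      + ⟪V t, -(μ t • x' t) - δ t • G t - ν • xt' t⟫
      + ν / 2 * (μ₁ t * ‖x t - xt t‖ ^ 2 + 2 * μ t * ⟪x t - xt t, x' t - xt' t⟫)
      + ⟪lam t - lt t, (ν * δ t) • (A (x t - xt t) + θ t • A (x' t) - e t • (lam t - lt t))
          - lt' t⟫) t := by
    intro t ht
    have hh := regularized_gap_hasDerivAt hf A (heder t ht) (hx t ht) (hxt t ht) (hlt t ht)
      (hopt t ht)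
    have h1 := (((hader t ht).mul hh).add ((hVder t ht).norm_sq.div_const 2)).add
      (((hμder t ht).mul ((hx t ht).sub (hxt t ht)).norm_sq).const_mul (ν / 2))
    have h2 := h1.add (((hlam t ht).sub (hlt t ht)).norm_sq.div_const 2)
    refine h2.congr_deriv ?_
    rw [hlamder t ht]
    simp only [Pi.sub_apply, hhdef, hwdef]
    ring
  -- the decay rate
  set r := max 0 (p - q - s) with hrdef
  have hr0 : 0 ≤ r := le_max_left _ _
  have hr1 : r < 1 := max_lt one_pos (by linarith)
  have hpow_e : ∀ t ≥ t₀, D t * e t = c * t ^ (q + s - p) := by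
    intro t ht
    simp only [hDdef, hedef, rpow_sub (htpos ht)]
    ring
  obtain ⟨K, ⟨hKa, hKk, hKγ, hKX, hKY⟩, hK⟩ : ∃ K : ℝ, (K * (k₁ + 2 * γ) ≤ ν / 4 ∧
      K * (6 * k₁) ≤ 1 ∧ K * (6 * γ) ≤ 1 ∧ K * (3 / 2 * ν + 1) ≤ c / 16 ∧
      K * 1 ≤ ν / 2 * c) ∧ 0 < K := by
    have h0 : Tendsto (fun K : ℝ => K) (𝓝[>] 0) (𝓝 0) := nhdsWithin_le_nhds
    have hk := fun (u : ℝ) {v : ℝ} (hv : 0 < v) => eventually_mul_le_of_tendsto_zero h0 u hv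
    exact (((hk _ (by positivity)).and ((hk _ one_pos).and ((hk _ one_pos).and
      ((hk _ (by positivity)).and (hk _ (by positivity)))))).and self_mem_nhdsWithin).exists
  set Cμ := q * (k₁ * (k₂ + q) + k₁) + k₁ * k₂ * (q + 1) with hCμ
  set N := 2 * (p * R * ((k₁ + 2 * γ) * ‖A‖ + ν ^ 2 + 2 * ν)) ^ 2 / ν + (p * R) ^ 2 / ν
    + c * (ν ^ 2 * (p * R) ^ 2 * (k₁ + γ)) + (k₁ + 2 * γ) * p * R ^ 2 / 2 with hNdef
  set η : ℝ → ℝ := fun t => N / K * (t ^ (r + q + s + p - 2) / c + c * t ^ (r + q + s - p - 1))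
    with hηdef
  have hηlim : Tendsto η atTop (𝓝 0) := by
    have hz : ∀ z : ℝ, z < 0 → Tendsto (fun t : ℝ => t ^ z) atTop (𝓝 0) := by
      intro z hz
      simpa using tendsto_rpow_neg_atTop (neg_pos.2 hz)
    have e1 : r + q + s + p - 2 < 0 := by
      have : r < 2 - q - s - p := max_lt (by linarith) (by linarith)
      linarith
    have e2 : r + q + s - p - 1 < 0 := by
      have : r < 1 + p - q - s := max_lt (by linarith) (by linarith)
      linarith
    simpa using (((hz _ e1).div_const c).add ((hz _ e2).const_mul c)).const_mul (N / K)
  have hSlim : Tendsto (fun t : ℝ => t⁻¹) atTop (𝓝 0) := tendsto_inv_atTop_zero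
  have hpowlim : Tendsto (fun t : ℝ => t ^ (-(q + s - p + 2))) atTop (𝓝 0) :=
    tendsto_rpow_neg_atTop (by linarith)
  have hbound : ∀ᶠ t in atTop, 0 ≤ E t ∧ ‖x t - xt t‖ ^ 2 ≤ 4 / ν * E t
      ∧ ‖lam t - lt t‖ ^ 2 ≤ 2 * E t ∧ ∀ E' : ℝ, HasDerivAt E E' t →
        E' ≤ K * t ^ (-r) * (η t - E t) := by
    filter_upwards [eventually_gt_atTop t₀, eventually_ge_atTop T₁, eventually_ge_atTop T₂,
      eventually_ge_atTop 1,
      eventually_mul_le_of_tendsto_zero hSlim (γ * q) one_half_pos,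
      eventually_mul_le_of_tendsto_zero hSlim ((q + k₂) * k₁) one_half_pos,
      eventually_mul_le_of_tendsto_zero hSlim (k₁ * (k₂ + q) + k₁ * (q + s + γ * q * (1 + q))
        + γ * (Cμ + 2 * q)) (show 0 < ν / 4 by positivity),
      eventually_mul_le_of_tendsto_zero hpowlim Cμ (show 0 < c / 16 by positivity)]
      with t ht htT₁ htT₂ ht1 hS2 hS3 hS4 hS5
    have ht' := htpos ht.le
    have hm := hmpos t ht.le
    have hQ := hQpos t ht.le
    have hD := hDpos t ht.le
    have he := hepos t ht.le
    have hQD : Q t ≤ D t := rpow_le_rpow_of_exponent_le ht1 (by linarith)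
    have hD1 : 1 ≤ D t := one_le_rpow ht1 (by linarith)
    have hS0 : 0 < t⁻¹ := inv_pos.2 ht'
    have hS1 : t⁻¹ ≤ 1 := inv_le_one_of_one_le₀ ht1
    have hM : m t * Q t ≤ k₁ := (le_div_iff₀ hQ).1 (hA1 t htT₁).2
    have hm₁ : |m' t| ≤ k₂ * m t * t⁻¹ := by
      rw [← div_eq_mul_inv, le_div_iff₀ ht', mul_comm]
      exact (hA2 t htT₂).1
    have hm₂ : |m'' t| ≤ k₂ * m t * t⁻¹ ^ 2 := by
      rw [inv_pow, ← div_eq_mul_inv, le_div_iff₀ (by positivity), mul_comm]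
      exact (hA2 t htT₂).2
    obtain ⟨hδl, hμl, hμu, hμ₁, ha0, haC, ha₁⟩ := lyapunov_coefficient_bounds hQ hQD hS0 hS1 hm
      hq0 hs hγ hk₂ hM hm₁ hm₂ hS2 hS3 hS4
    change D t / 2 ≤ δ t at hδl
    change 1 / 2 ≤ μ t at hμl
    change μ t ≤ 2 at hμu
    change |μ₁ t| ≤ Cμ * t⁻¹ ^ 2 at hμ₁
    change 0 ≤ a t at ha0
    change a t ≤ (k₁ + 2 * γ) * D t at haC
    change a₁ t ≤ ν / 4 * D t at ha₁
    have hδ0 : 0 < δ t := lt_of_lt_of_le (half_pos hD) hδl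
    have hμ0 : 0 < μ t := by linarith
    have hM0 : 0 < m t * Q t := mul_pos hm hQ
    have hh0 : 0 ≤ h t := regularized_gap_nonneg hf hconv A he (hopt t ht.le)
    have hw : h t + e t / 2 * ‖x t - xt t‖ ^ 2 ≤ ⟪w t, x t - xt t⟫ :=
      regularized_gap_le_inner hf hconv A (e t) (x t) (xt t) (lt t)
    have hah : 0 ≤ a t * h t := mul_nonneg ha0 hh0
    have hX0 := norm_nonneg (x t - xt t)
    have hμX : 1 / 2 * ‖x t - xt t‖ ^ 2 ≤ μ t * ‖x t - xt t‖ ^ 2 :=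
      mul_le_mul_of_nonneg_right hμl (sq_nonneg _)
    have hνμX := mul_le_mul_of_nonneg_left hμX (half_pos hν).le
    have hνX : 0 ≤ ν * ‖x t - xt t‖ ^ 2 := by positivity
    have hEt : E t = a t * h t + ‖V t‖ ^ 2 / 2 + ν / 2 * (μ t * ‖x t - xt t‖ ^ 2)
      + ‖lam t - lt t‖ ^ 2 / 2 := rfl
    have hV2 := sq_nonneg ‖V t‖
    have hY2 := sq_nonneg ‖lam t - lt t‖
    refine ⟨by linarith, ?_, by linarith, ?_⟩
    · rw [div_mul_eq_mul_div, le_div_iff₀ hν]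
      linarith
    intro E' hE'
    rw [hE'.unique (hEder t ht.le)]
    have hεeq : |-(p * e t * t⁻¹)| = p * e t * t⁻¹ := by
      rw [abs_neg, abs_of_pos (by positivity)]
    have hd := lyapunov_deriv_le A (ξ := x t - xt t) (v := x' t) (w := w t) (x₁ := x t)
      (a₁ := a₁ t) (μ₁ := μ₁ t) hν hγ hQ hm hμ0
      hδ0 ha0 (show a t = m t * Q t * δ t + μ t * γ * Q t from rfl) (hθa t ht.le hδ0.ne')
      (show -(p * e t * t⁻¹) ≤ 0 from neg_nonpos.2 (by positivity)) (hxR t ht.le)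
      (hrate t ht).1 (hrate t ht).2 hw (η := lam t - lt t)
    change _ ≤ a₁ t * h t + a t * (p * R * t⁻¹ * ‖A‖ * ‖x t - xt t‖
        + |-(p * e t * t⁻¹)| / 2 * R ^ 2) - μ t * (m t * Q t) * ‖x' t‖ ^ 2
      - γ * Q t * δ t * ‖G t‖ ^ 2
      - ν * δ t * (h t + e t / 2 * ‖x t - xt t‖ ^ 2) - ν * δ t * e t * ‖lam t - lt t‖ ^ 2
      + ν * (p * R * t⁻¹) * (ν * ‖x t - xt t‖ + m t * Q t * ‖x' t‖ + γ * Q t * ‖G t‖)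
      + ν / 2 * |μ₁ t| * ‖x t - xt t‖ ^ 2 + ν * μ t * (p * R * t⁻¹) * ‖x t - xt t‖
      + p * R * t⁻¹ * ‖lam t - lt t‖ at hd
    set κ := K * t ^ (-r) with hκdef
    have htr : 0 < t ^ (-r) := rpow_pos_of_pos ht' _
    have hκ : 0 < κ := mul_pos hK htr
    have hκK : κ ≤ K := mul_le_of_le_one_right hK.le (rpow_le_one_of_one_le_of_nonpos ht1
      (by linarith))
    have hκe : c * κ ≤ K * (D t * e t) := by
      have e1 : t ^ (-r) ≤ t ^ (q + s - p) := rpow_le_rpow_of_exponent_le ht1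
        (by linarith [le_max_right 0 (p - q - s)])
      rw [hpow_e t ht.le, hκdef]
      have := mul_le_mul_of_nonneg_left e1 (mul_pos hc hK).le
      linarith
    have hκle : ∀ {u v : ℝ}, 0 ≤ u → K * u ≤ v → κ * u ≤ v := fun hu hv =>
      (mul_le_mul_of_nonneg_right hκK hu).trans hv
    have hDe : 0 < D t * e t := mul_pos hD he
    have hκle' : ∀ {u v : ℝ}, 0 ≤ u → K * u ≤ c * v → κ * u ≤ v * (D t * e t) := by
      intro u v hu hv
      refine le_of_mul_le_mul_left ?_ hc
      have e1 := mul_le_mul_of_nonneg_right hκe hu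
      have e2 := mul_le_mul_of_nonneg_right hv hDe.le
      linarith
    have hμ₁' : |μ₁ t| ≤ D t * e t / 16 := by
      refine hμ₁.trans ?_
      rw [hpow_e t ht.le]
      have e1 : t ^ (-(q + s - p + 2)) = t⁻¹ ^ 2 * (t ^ (q + s - p))⁻¹ := by
        rw [rpow_neg ht'.le, rpow_add ht', rpow_two, mul_inv, inv_pow, mul_comm]
      have e2 : 0 < t ^ (q + s - p) := rpow_pos_of_pos ht' _
      rw [e1] at hS5
      have e3 := mul_le_mul_of_nonneg_right hS5 e2.le
      have e4 : t⁻¹ ^ 2 * (t ^ (q + s - p))⁻¹ * Cμ * t ^ (q + s - p) = Cμ * t⁻¹ ^ 2 := by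
        field_simp
      linarith
    have hec : e t ≤ c := div_le_self hc.le (one_le_rpow ht1 hp0.le)
    have hsc := lyapunov_scalar_estimate (R := R) (V := ‖x' t‖) (G := ‖G t‖)
      (Y := ‖lam t - lt t‖) hν hγ hQ hQD hD1 hS0 hM0.le hM hμl hμu
      hμ₁' hδl ha₁ ha0 haC he hec hεeq.le hh0 hX0 (mul_pos hp0 hR).le rfl (norm_nonneg A) hκ.le
      (hκle (by positivity) hKa) (hκle (by positivity) hKk) (hκle (by positivity) hKγ)
      ((hκle' (u := 3 / 2 * ν + 1) (v := 1 / 16) (by positivity) (by linarith)).trans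
        (le_of_eq (by ring)))
      (by simpa using hκle' (u := 1) (v := ν / 2) zero_le_one (by linarith))
    have hVn : ‖V t‖ ≤ ν * ‖x t - xt t‖ + m t * Q t * ‖x' t‖ + γ * Q t * ‖G t‖ := by
      have e1 : V t = ν • (x t - xt t) + (m t * Q t) • x' t + (γ * Q t) • G t := by
        simp only [hVdef]; module
      rw [e1]
      refine norm_add₃_le.trans (le_of_eq ?_)
      rw [norm_smul, norm_smul, norm_smul, Real.norm_of_nonneg hν.le,
        Real.norm_of_nonneg hM0.le, Real.norm_of_nonneg (mul_pos hγ hQ).le]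
    have hV' := sq_add_three_le (norm_nonneg _) hVn
    have hEub : E t ≤ a t * h t + 3 / 2 * (ν ^ 2 * ‖x t - xt t‖ ^ 2
        + (m t * Q t) ^ 2 * ‖x' t‖ ^ 2 + γ ^ 2 * Q t ^ 2 * ‖G t‖ ^ 2)
        + ν * ‖x t - xt t‖ ^ 2 + ‖lam t - lt t‖ ^ 2 / 2 := by
      have e1 : μ t * ‖x t - xt t‖ ^ 2 ≤ 2 * ‖x t - xt t‖ ^ 2 :=
        mul_le_mul_of_nonneg_right hμu (sq_nonneg _)
      have e2 := mul_le_mul_of_nonneg_left e1 (half_pos hν).le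
      have e3 : (ν * ‖x t - xt t‖) ^ 2 + (m t * Q t * ‖x' t‖) ^ 2 + (γ * Q t * ‖G t‖) ^ 2
          = ν ^ 2 * ‖x t - xt t‖ ^ 2 + (m t * Q t) ^ 2 * ‖x' t‖ ^ 2
            + γ ^ 2 * Q t ^ 2 * ‖G t‖ ^ 2 := by ring
      rw [e3] at hV'
      linarith
    have hκE := mul_le_mul_of_nonneg_left hEub hκ.le
    have hκη : κ * η t = N * (D t * t⁻¹ ^ 2 / e t + D t * t⁻¹ * e t) := by
      have e1 : t ^ (r + q + s + p - 2) = t ^ r * (D t * t⁻¹ ^ 2 * t ^ p) := by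
        rw [rpow_sub ht', rpow_add ht', add_assoc, rpow_add ht', rpow_two, inv_pow]
        simp only [hDdef]
        ring
      have e2 : t ^ (r + q + s - p - 1) = t ^ r * (D t * t⁻¹ * (t ^ p)⁻¹) := by
        rw [rpow_sub_one ht'.ne', rpow_sub ht', add_assoc, rpow_add ht']
        simp only [hDdef]
        ring
      have e3 : 0 < t ^ r := rpow_pos_of_pos ht' _
      have e4 : 0 < t ^ p := rpow_pos_of_pos ht' _
      simp only [hηdef, hκdef, e1, e2, hedef, rpow_neg ht'.le]
      field_simp
    rw [mul_sub κ, hκη]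
    change _ ≤ N * (D t * t⁻¹ ^ 2 / e t + D t * t⁻¹ * e t) at hsc
    refine hd.trans ?_
    linarith only [hsc, hκE]
  -- conclusion
  obtain ⟨T, hT⟩ := eventually_atTop.1 (hbound.and (eventually_ge_atTop t₀))
  have hT₀ : t₀ ≤ T := (hT T le_rfl).2
  have hElim : Tendsto E atTop (𝓝 0) :=
    tendsto_zero_of_deriv_le hK hr1 (htpos hT₀) (fun t ht => hEder t (hT₀.trans ht))
      (fun t ht => (hT t ht).1.1)
      (fun t ht => (hT t ht).1.2.2.2 _ (hEder t (hT₀.trans ht))) hηlim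
  have hxc : Tendsto (fun t => x t - xs) atTop (𝓝 0) := by
    have h1 := tendsto_zero_of_norm_sq_le (z := fun t => x t - xt t) hElim fun t ht => (hT t ht).1.2.1
    simpa using h1.add (hxlim.sub_const xs)
  have hlc : Tendsto (fun t => lam t - ls) atTop (𝓝 0) := by
    have h1 := tendsto_zero_of_norm_sq_le (z := fun t => lam t - lt t) hElim fun t ht => (hT t ht).1.2.2.1
    simpa using h1.add (hllim.sub_const ls)
  simpa using ((hxc.norm.pow 2).add (hlc.norm.pow 2)).sqrt
end
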